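/- arXiv:2404.17921 — 3 statements merged into one kernel-verified Lean document; each statement's English description precedes it below -/
import Mathlib

section
/- Let a, b ∈ ℤ with (a mod 4, b mod 4) ∈ {(1,3), (3,1), (3,3)}. If the integer (b+2−2a)(b+2+2a)(a²−4b+8) is squarefree, then the polynomial G(x) = x⁸ + a·x⁶ + b·x⁴ + a·x² + 1 is monogenic. -/
open Polynomial

/-- A monic polynomial `f ∈ ℤ[x]` is *monogenic* if it is irreducible over `ℚ` and,
for any number field `K` generated over `ℚ` by a root `θ` of `f`, the ring `ℤ[θ]`
is the full ring of integers (the integral closure of `ℤ`) of `K`. -/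
def IsMonogenic (f : Polynomial ℤ) : Prop :=
  f.Monic ∧ Irreducible (f.map (Int.castRingHom ℚ)) ∧
    ∀ (K : Type) [Field K] [NumberField K] (θ : K),
      Polynomial.aeval θ f = 0 →
      Algebra.adjoin ℚ {θ} = (⊤ : Subalgebra ℚ K) →
      Algebra.adjoin ℤ {θ} = integralClosure ℤ K

theorem irreducible_cyclotomic_five_zmod_two : Irreducible (cyclotomic 5 (ZMod 2)) := by
  have : Fact (Nat.Prime 2) := ⟨Nat.prime_two⟩
  refine ZMod.irreducible_of_dvd_cyclotomic_of_natDegree (p := 2) (n := 5) (by norm_num) dvd_rfl ?_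
  rw [natDegree_cyclotomic, Nat.totient_prime (by norm_num)]
  symm
  refine orderOf_eq_prime_pow (p := 2) (n := 1) ?_ ?_ <;> decide +revert

theorem cyclotomic_five (R : Type*) [CommRing R] :
    cyclotomic 5 R = X ^ 4 + X ^ 3 + X ^ 2 + X + 1 := by
  have : Fact (Nat.Prime 5) := ⟨by norm_num⟩
  rw [cyclotomic_prime]
  simp only [Finset.sum_range_succ, Finset.sum_range_zero]
  ring

theorem even_reciprocal_octic_monic (a b : ℤ) :
    (X ^ 8 + C a * X ^ 6 + C b * X ^ 4 + C a * X ^ 2 + 1 : ℤ[X]).Monic := by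
  monicity!

theorem even_reciprocal_octic_irreducible (a b : ℤ) (ha : a % 2 = 1) (hb : b % 2 = 1)
    (hab : ¬ (a % 4 = 1 ∧ b % 4 = 1)) :
    Irreducible (X ^ 8 + C a * X ^ 6 + C b * X ^ 4 + C a * X ^ 2 + 1 : ℤ[X]) := by
  have : Fact (Nat.Prime 2) := ⟨Nat.prime_two⟩
  have hmonic := even_reciprocal_octic_monic a b
  have hmod : (X ^ 8 + C a * X ^ 6 + C b * X ^ 4 + C a * X ^ 2 + 1 : ℤ[X]) %ₘ cyclotomic 5 ℤ
      = C (1 - b) * X ^ 3 + C (a - b) * X ^ 2 + C (a - b) * X + C (1 - b) := by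
    refine (div_modByMonic_unique (X ^ 4 - X ^ 3 + C a * X ^ 2 - C a * X + C b) _
      (cyclotomic.monic 5 ℤ) ⟨?_, ?_⟩).2
    · rw [cyclotomic_five]
      simp only [C_sub, C_1]
      ring
    · rw [degree_cyclotomic, Nat.totient_prime (by norm_num)]
      compute_degree!
  have hodd : ∀ n : ℤ, n % 2 = 1 → (C n : ℤ[X]).map (Int.castRingHom (ZMod 2)) = 1 := by
    intro n hn
    have : (n : ZMod 2) = 1 := by
      rw [← Int.cast_one, ZMod.intCast_eq_intCast_iff]
      exact hn
    rw [map_C, eq_intCast, this, C_1]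
  refine generalizedEisenstein (K := ZMod 2) (q := cyclotomic 5 ℤ) (p := 2) ?_
    (cyclotomic.monic 5 ℤ) hmonic.isPrimitive ?_ ?_ ?_ ?_
  · simpa using irreducible_cyclotomic_five_zmod_two
  · rw [show natDegree _ = 8 by compute_degree!]
    norm_num
  · rw [hmonic.leadingCoeff]; simp
  · rw [hmonic.leadingCoeff]
    simp only [cyclotomic_five, map_one, one_mul, algebraMap_int_eq,
      Polynomial.map_add, Polynomial.map_mul, Polynomial.map_pow, map_X,
      Polynomial.map_one, hodd a ha, hodd b hb]
    have h2 : (2 : (ZMod 2)[X]) = 0 := CharTwo.two_eq_zero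
    linear_combination (-X ^ 7 - X ^ 6 - 2 * X ^ 5 - 2 * X ^ 4 - 2 * X ^ 3 - X ^ 2 - X) * h2
  · rw [hmod]
    intro h
    have hmem : ∀ n : ℤ, Ideal.Quotient.mk (RingHom.ker (algebraMap ℤ (ZMod 2)) ^ 2) n = 0 →
        n % 4 = 0 := by
      intro n hn
      rw [Ideal.Quotient.eq_zero_iff_mem, algebraMap_int_eq, ZMod.ker_intCastRingHom,
        Ideal.span_singleton_pow, Ideal.mem_span_singleton] at hn
      norm_num at hn
      omega
    have h0 := hmem _ ((coeff_map _ 0).symm.trans (congrArg (coeff · 0) h))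
    have h1 := hmem _ ((coeff_map _ 1).symm.trans (congrArg (coeff · 1) h))
    simp [-eq_intCast, -map_sub, coeff_X, coeff_C] at h0 h1
    omega
/-- If `T(x)` lies in a prime `M` above `p` of `ℤ[x]` and `T'(x)` does not, then
`M` is generated by `p` and `T(x)` locally at `M`. -/
theorem exists_mul_eq_add_of_derivative_notMem {O : Type*} [CommRing O] {x : O}
    (hx : Function.Surjective (aeval x : ℤ[X] →ₐ[ℤ] O)) (M : Ideal O) [M.IsPrime]
    (p : ℕ) [Fact p.Prime] (hp : (p : O) ∈ M) (T : ℤ[X]) (hT : aeval x T ∈ M)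
    (hT' : aeval x (derivative T) ∉ M) {m : O} (hm : m ∈ M) :
    ∃ s ∉ M, ∃ u v : O, s * m = u * aeval x T + v * p := by
  let red : ℤ[X] →+* (ZMod p)[X] := mapRingHom (Int.castRingHom (ZMod p))
  have hred : Function.Surjective red := map_surjective _ (ZMod.ringHom_surjective _)
  have hker : ∀ h, red h = 0 → ∃ k, h = C (p : ℤ) * k := by
    intro h hh
    refine (C_dvd_iff_dvd_coeff _ _).2 fun i => ?_
    rw [← ZMod.intCast_zmod_eq_zero_iff_dvd]
    simpa [red] using congrArg (coeff · i) hh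
  let N : Ideal ℤ[X] := M.comap (aeval x : ℤ[X] →ₐ[ℤ] O)
  have hmemN : ∀ h, h ∈ N ↔ aeval x h ∈ M := fun h => Ideal.mem_comap
  have hmem : ∀ h, red h ∈ N.map red → h ∈ N := by
    intro h hh
    obtain ⟨h', hh', heq⟩ := (Ideal.mem_map_iff_of_surjective red hred).1 hh
    obtain ⟨k, hk⟩ := hker (h - h') (by rw [map_sub, heq, sub_self])
    have : h = h' + C (p : ℤ) * k := by rw [← hk]; ring
    rw [this]
    refine N.add_mem hh' (N.mul_mem_right _ ?_)
    rw [hmemN]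
    simpa using hp
  obtain ⟨φ, hφ⟩ := (IsPrincipalIdealRing.principal (N.map red)).principal
  rw [Ideal.submodule_span_eq] at hφ
  obtain ⟨m, rfl⟩ := hx m
  obtain ⟨k, hk⟩ : φ ∣ red m := by
    rw [← Ideal.mem_span_singleton, ← hφ]
    exact Ideal.mem_map_of_mem _ hm
  obtain ⟨s, hs⟩ : φ ∣ red T := by
    rw [← Ideal.mem_span_singleton, ← hφ]
    exact Ideal.mem_map_of_mem _ hT
  obtain ⟨k, rfl⟩ := hred k
  obtain ⟨s, rfl⟩ := hred s
  refine ⟨aeval x s, fun hsM => hT' ?_, ?_⟩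
  · refine (hmemN _).1 (hmem _ ?_)
    have : red (derivative T) = derivative φ * red s + φ * derivative (red s) := by
      rw [← derivative_mul, ← hs]
      simp [red, derivative_map]
    rw [this]
    refine Ideal.add_mem _ (Ideal.mul_mem_left _ _ (Ideal.mem_map_of_mem _ hsM))
      (Ideal.mul_mem_right _ _ ?_)
    rw [hφ]
    exact Ideal.mem_span_singleton_self φ
  · obtain ⟨v, hv⟩ := hker (s * m - k * T) (by
      rw [map_sub, map_mul, map_mul, hs, hk]; ring)
    refine ⟨aeval x k, aeval x v, ?_⟩
    have := congrArg (aeval x) hv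
    rw [map_sub, map_mul, map_mul, map_mul, aeval_C, algebraMap_int_eq, eq_intCast,
      Int.cast_natCast] at this
    linear_combination this

/-- A noetherian domain whose maximal ideals are locally principal is integrally closed. -/
theorem isIntegrallyClosed_of_locally_principal {O : Type*} [CommRing O] [IsDomain O]
    [IsNoetherianRing O]
    (h : ∀ M : Ideal O, M ≠ ⊥ → M.IsMaximal → ∃ π ∈ M, ∀ m ∈ M, ∃ s ∉ M, π ∣ s * m) :
    IsIntegrallyClosed O := by
  refine IsIntegrallyClosed.of_localization_maximal fun M hM₀ hM => ?_
  obtain ⟨π, hπ, hgen⟩ := h M hM₀ hM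
  have : IsNoetherianRing (Localization.AtPrime M) :=
    IsLocalization.isNoetherianRing M.primeCompl _ inferInstance
  suffices hmax : (IsLocalRing.maximalIdeal (Localization.AtPrime M)).IsPrincipal from
    ((tfae_of_isNoetherianRing_of_isLocalRing_of_isDomain (Localization.AtPrime M)).out 4 3 :
      _ ↔ IsIntegrallyClosed (Localization.AtPrime M) ∧ _).1 hmax |>.1
  refine ⟨⟨algebraMap O _ π, ?_⟩⟩
  rw [Ideal.submodule_span_eq, ← Localization.AtPrime.map_eq_maximalIdeal]
  refine le_antisymm (Ideal.map_le_iff_le_comap.2 fun m hm => ?_) ?_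
  · obtain ⟨s, hs, u, hu⟩ := hgen m hm
    rw [Ideal.mem_comap, Ideal.mem_span_singleton]
    have hunit : IsUnit (algebraMap O (Localization.AtPrime M) s) :=
      IsLocalization.map_units _ (⟨s, hs⟩ : M.primeCompl)
    rw [← hunit.dvd_mul_left, ← map_mul, hu, map_mul]
    exact dvd_mul_right _ _
  · rw [Ideal.span_singleton_le_iff_mem]
    exact Ideal.mem_map_of_mem _ hπ

/-- Local principality of a prime `M` of `ℤ[x]` above `p`. -/
theorem exists_local_generator {O : Type*} [CommRing O] {x : O}
    (hx : Function.Surjective (aeval x : ℤ[X] →ₐ[ℤ] O)) (M : Ideal O) [M.IsPrime]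
    (p : ℕ) [Fact p.Prime] (hp : (p : O) ∈ M) (T : ℤ[X]) (hT : aeval x T ∈ M)
    (hT' : aeval x (derivative T) ∉ M) (h : aeval x T = 0 ∨ ∃ s ∉ M, aeval x T ∣ s * p) :
    ∃ π ∈ M, ∀ m ∈ M, ∃ s ∉ M, π ∣ s * m := by
  rcases h with h | ⟨s₀, hs₀, w, hw⟩
  · refine ⟨p, hp, fun m hm => ?_⟩
    obtain ⟨s, hs, u, v, e⟩ := exists_mul_eq_add_of_derivative_notMem hx M p hp T hT hT' hm
    exact ⟨s, hs, v, by rw [e, h]; ring⟩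
  · refine ⟨_, hT, fun m hm => ?_⟩
    obtain ⟨s, hs, u, v, e⟩ := exists_mul_eq_add_of_derivative_notMem hx M p hp T hT hT' hm
    refine ⟨s₀ * s, fun hmem => ?_, s₀ * u + v * w, ?_⟩
    · exact (Ideal.IsPrime.mem_or_mem ‹_› hmem).elim hs₀ hs
    · linear_combination s₀ * e + v * hw

/-- The ring generated by an integral element is all of the ring of integers as soon as it is
integrally closed. -/
theorem adjoin_eq_integralClosure_of_isIntegrallyClosed {K : Type*} [Field K] [CharZero K]
    (θ : K) (hθ : IsIntegral ℤ θ) (htop : Algebra.adjoin ℚ {θ} = (⊤ : Subalgebra ℚ K))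
    (h : IsIntegrallyClosed (Algebra.adjoin ℤ {θ})) :
    Algebra.adjoin ℤ {θ} = integralClosure ℤ K := by
  have hle : Algebra.adjoin ℤ {θ} ≤ integralClosure ℤ K :=
    Algebra.adjoin_le (Set.singleton_subset_iff.2 hθ)
  have hden : ∀ z : K, ∃ n : ℤ, n ≠ 0 ∧ (n : K) * z ∈ Algebra.adjoin ℤ {θ} := by
    intro z
    have hz : z ∈ Algebra.adjoin ℚ {θ} := htop ▸ Algebra.mem_top
    induction hz using Algebra.adjoin_induction with
    | mem y hy => exact ⟨1, one_ne_zero, by simpa using Algebra.subset_adjoin hy⟩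
    | algebraMap r =>
      refine ⟨r.den, by exact_mod_cast r.den_ne_zero, ?_⟩
      have : ((r.den : ℤ) : K) * algebraMap ℚ K r = (r.num : K) := by
        rw [eq_ratCast]
        exact_mod_cast congrArg (Rat.cast : ℚ → K) (Rat.den_mul_eq_num r)
      rw [this]
      exact intCast_mem _ _
    | add y z _ _ hy hz =>
      obtain ⟨m, hm, hy⟩ := hy
      obtain ⟨n, hn, hz⟩ := hz
      refine ⟨m * n, mul_ne_zero hm hn, ?_⟩
      have := add_mem (mul_mem (intCast_mem (Algebra.adjoin ℤ {θ}) n) hy)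
        (mul_mem (intCast_mem (Algebra.adjoin ℤ {θ}) m) hz)
      convert this using 1
      push_cast
      ring
    | mul y z _ _ hy hz =>
      obtain ⟨m, hm, hy⟩ := hy
      obtain ⟨n, hn, hz⟩ := hz
      refine ⟨m * n, mul_ne_zero hm hn, ?_⟩
      convert mul_mem hy hz using 1
      push_cast
      ring
  have : IsFractionRing (Algebra.adjoin ℤ {θ}) K := by
    refine IsFractionRing.of_field _ _ fun z => ?_
    obtain ⟨n, hn, hz⟩ := hden z
    refine ⟨⟨_, hz⟩, (n : Algebra.adjoin ℤ {θ}), ?_⟩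
    have hn' : (n : K) ≠ 0 := by exact_mod_cast hn
    rw [eq_div_iff (by simpa using hn'), map_intCast, mul_comm]
    rfl
  refine le_antisymm hle fun z hz => ?_
  obtain ⟨y, rfl⟩ := (isIntegrallyClosed_iff K).1 h
    (IsIntegral.tower_top (A := Algebra.adjoin ℤ {θ}) hz)
  exact y.2

/-- Every prime of `ℤ[x]` above `p` is locally principal, where `x` is a root of the octic. -/
theorem even_reciprocal_octic_local_generator {O : Type*} [CommRing O] {x : O}
    (hx : Function.Surjective (aeval x : ℤ[X] →ₐ[ℤ] O)) (M : Ideal O) [M.IsPrime]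
    (p : ℕ) [hpp : Fact p.Prime] (hp : (p : O) ∈ M) (a b : ℤ)
    (ha : a % 2 = 1) (hb : b % 2 = 1) (hab : ¬ (a % 4 = 1 ∧ b % 4 = 1))
    (hsf : Squarefree ((b + 2 - 2 * a) * (b + 2 + 2 * a) * (a ^ 2 - 4 * b + 8)))
    (hroot : x ^ 8 + a * x ^ 6 + b * x ^ 4 + a * x ^ 2 + 1 = 0) :
    ∃ π ∈ M, ∀ m ∈ M, ∃ s ∉ M, π ∣ s * m := by
  have hmem : ∀ r : O, r ∈ M ↔ Ideal.Quotient.mk M r = 0 := fun r =>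
    Ideal.Quotient.eq_zero_iff_mem.symm
  have hcast : ∀ n : ℤ, (n : O ⧸ M) = 0 ↔ (p : ℤ) ∣ n := by
    have hp0 : (p : O ⧸ M) = 0 := by simpa using (hmem _).1 hp
    have : CharP (O ⧸ M) p := by
      obtain ⟨q, hq⟩ := CharP.exists (O ⧸ M)
      have hqp : q ∣ p := (CharP.cast_eq_zero_iff (O ⧸ M) q p).1 hp0
      rcases (Nat.dvd_prime hpp.out).1 hqp with rfl | rfl
      · exact absurd rfl (CharP.char_ne_one (O ⧸ M) 1)
      · exact hq
    exact fun n => CharP.intCast_eq_zero_iff (O ⧸ M) p n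
  have hnsq : ∀ n : ℤ, n * n ∣ (b + 2 - 2 * a) * (b + 2 + 2 * a) * (a ^ 2 - 4 * b + 8) →
      n ≠ p := by
    rintro n hn rfl
    exact (Nat.prime_iff_prime_int.1 hpp.out).not_isUnit (hsf _ hn)
  -- a factor of the squarefree product divisible by `p` is `p` times a unit at `M`
  have hexact : ∀ W : ℤ, W ∣ (b + 2 - 2 * a) * (b + 2 + 2 * a) * (a ^ 2 - 4 * b + 8) →
      (W : O ⧸ M) = 0 → ∃ w : ℤ, W = p * w ∧ (w : O ⧸ M) ≠ 0 := by
    intro W hW hW0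
    obtain ⟨w, rfl⟩ := (hcast W).1 hW0
    refine ⟨w, rfl, fun hw => hnsq p (dvd_trans ?_ hW) rfl⟩
    exact mul_dvd_mul_left _ ((hcast w).1 hw)
  set z : O ⧸ M := Ideal.Quotient.mk M x with hz
  have hzroot : z ^ 8 + a * z ^ 6 + b * z ^ 4 + a * z ^ 2 + 1 = 0 := by
    simpa using congrArg (Ideal.Quotient.mk M) hroot
  have hz0 : z ≠ 0 := by
    intro h
    rw [h] at hzroot
    simp at hzroot
  by_cases h2 : p = 2
  · subst h2
    have htwo : (2 : O ⧸ M) = 0 := by simpa [map_ofNat] using (hmem _).1 hp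
    obtain ⟨a', ha'⟩ : ∃ a', a = 2 * a' + 1 := ⟨a / 2, by omega⟩
    obtain ⟨b', hb'⟩ : ∃ b', b = 2 * b' + 1 := ⟨b / 2, by omega⟩
    have hphi : z ^ 4 + z ^ 3 + z ^ 2 + z + 1 = 0 := by
      refine pow_eq_zero_iff (two_ne_zero) |>.1 ?_
      rw [ha', hb'] at hzroot
      push_cast at hzroot
      linear_combination hzroot + (z ^ 7 + (1 - a') * z ^ 6 + 2 * z ^ 5 + (2 - b') * z ^ 4
        + 2 * z ^ 3 + (1 - a') * z ^ 2 + z) * htwo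
    have hz1 : z + 1 ≠ 0 := by
      intro h
      refine one_ne_zero (α := O ⧸ M) ?_
      linear_combination hphi - (z ^ 3 + z) * h
    refine exists_local_generator hx M 2 hp (X ^ 4 + X ^ 3 + X ^ 2 + X + 1) ?_ ?_ (Or.inr ?_)
    · rw [hmem]
      simpa using hphi
    · rw [hmem]
      intro h
      refine pow_ne_zero 2 hz1 ?_
      simp [← hz, map_ofNat] at h
      linear_combination h - (2 * z ^ 3 + z ^ 2) * htwo
    · refine ⟨-b' * x ^ 3 + (a' - b') * x ^ 2 + (a' - b') * x - b', ?_,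
        -(x ^ 4 - x ^ 3 + a * x ^ 2 - a * x + b), ?_⟩
      · rw [hmem]
        simp only [map_add, map_sub, map_mul, map_neg, map_pow, map_intCast, ← hz]
        intro h
        have hpar : ∀ n : ℤ, ∃ c : O ⧸ M, (n : O ⧸ M) = 2 * c + (n % 2 : ℤ) := by
          intro n
          refine ⟨(n / 2 : ℤ), ?_⟩
          exact_mod_cast congrArg (Int.cast : ℤ → O ⧸ M) (Int.mul_ediv_add_emod n 2).symm
        obtain ⟨c, hc⟩ := hpar a'
        obtain ⟨d, hd⟩ := hpar b'
        rw [hc, hd] at h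
        rcases Int.emod_two_eq_zero_or_one a' with h1 | h1 <;>
          rcases Int.emod_two_eq_zero_or_one b' with h3 | h3 <;>
          rw [h1, h3] at h <;> push_cast at h
        · omega
        · have hz4 : z ^ 4 = 0 := by
            linear_combination hphi + h + (d * z ^ 3 - (c - d) * z ^ 2 - (c - d) * z + d) * htwo
          exact pow_ne_zero 4 hz0 hz4
        · have : z * (z + 1) = 0 := by
            linear_combination h - (-d * z ^ 3 + (c - d) * z ^ 2 + (c - d) * z - d) * htwo
          exact mul_ne_zero hz0 hz1 this
        · have hz3 : z ^ 3 + 1 = 0 := by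
            linear_combination -h + (-d * z ^ 3 + (c - d) * z ^ 2 + (c - d) * z - d) * htwo
          have : z ^ 2 = 0 := by
            linear_combination hphi - (z + 1) * hz3
          exact pow_ne_zero 2 hz0 this
      · rw [ha', hb'] at hroot ⊢
        simp only [map_add, map_pow, map_one, aeval_X]
        push_cast at hroot ⊢
        linear_combination hroot
  have hpodd : ¬ (p : ℤ) ∣ 2 := by
    intro h
    exact h2 ((Nat.prime_dvd_prime_iff_eq hpp.out Nat.prime_two).1 (by exact_mod_cast h))
  have htwo : (2 : O ⧸ M) ≠ 0 := fun h => hpodd ((hcast 2).1 (by exact_mod_cast h))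
  by_cases hder : (z ^ 4 - 1) * (2 * z ^ 4 + a * z ^ 2 + 2) = 0
  · rcases mul_eq_zero.1 hder with h | h
    · have hsq : (z ^ 2 + 1) * (z ^ 2 - 1) = 0 := by linear_combination h
      rcases mul_eq_zero.1 hsq with h | h
      · obtain ⟨w, hw, hw0⟩ := hexact (b + 2 - 2 * a) ⟨_, mul_assoc _ _ _⟩ (by
          push_cast
          linear_combination hzroot - (z ^ 6 + (a - 1) * z ^ 4 + (b - a + 1) * z ^ 2
            + (2 * a - b - 1)) * h)
        refine exists_local_generator hx M p hp (X ^ 2 + 1) ?_ ?_ (Or.inr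
          ⟨w * (1 - 2 * (x ^ 2 + 1)), ?_,
            -(x ^ 2 + 1) * (x ^ 4 + (a - 2) * x ^ 2 + (b - 2 * a + 3)), ?_⟩)
        · rw [hmem]
          simpa using h
        · rw [hmem]
          simpa [← hz, map_ofNat] using mul_ne_zero htwo hz0
        · rw [hmem]
          simp only [map_mul, map_sub, map_one, map_add, map_pow, map_intCast, ← hz, h]
          simpa using hw0
        · have hw' : (b + 2 - 2 * a : O) = p * w := by exact_mod_cast congrArg (Int.cast : ℤ → O) hw
          simp only [map_add, map_pow, map_one, aeval_X]
          linear_combination hroot - (1 - 2 * (x ^ 2 + 1)) * hw'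
      · obtain ⟨w, hw, hw0⟩ := hexact (b + 2 + 2 * a)
          ((dvd_mul_left _ _).trans (dvd_mul_right _ _)) (by
          push_cast
          linear_combination hzroot - (z ^ 6 + (a + 1) * z ^ 4 + (b + a + 1) * z ^ 2
            + (2 * a + b + 1)) * h)
        refine exists_local_generator hx M p hp (X ^ 2 - 1) ?_ ?_ (Or.inr
          ⟨w * (1 + 2 * (x ^ 2 - 1)), ?_,
            -(x ^ 2 - 1) * (x ^ 4 + (a + 2) * x ^ 2 + (b + 2 * a + 3)), ?_⟩)
        · rw [hmem]
          simpa using h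
        · rw [hmem]
          simpa [← hz, map_ofNat] using mul_ne_zero htwo hz0
        · rw [hmem]
          simp only [map_mul, map_sub, map_one, map_add, map_pow, map_intCast, ← hz, h]
          simpa using hw0
        · have hw' : (b + 2 + 2 * a : O) = p * w := by exact_mod_cast congrArg (Int.cast : ℤ → O) hw
          simp only [map_sub, map_pow, map_one, aeval_X]
          linear_combination hroot - (1 + 2 * (x ^ 2 - 1)) * hw'
    · have hW : (a ^ 2 - 4 * b + 8 : O ⧸ M) = 0 := by
        refine (mul_eq_zero.1 (?_ : z ^ 4 * (a ^ 2 - 4 * b + 8 : O ⧸ M) = 0)).resolve_left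
          (pow_ne_zero 4 hz0)
        linear_combination (2 * z ^ 4 + a * z ^ 2 + 2) * h - 4 * hzroot
      obtain ⟨w, hw, hw0⟩ := hexact (a ^ 2 - 4 * b + 8) (dvd_mul_left _ _) (by exact_mod_cast hW)
      refine exists_local_generator hx M p hp (2 * X ^ 4 + C a * X ^ 2 + 2) ?_ ?_ (Or.inr
        ⟨w * x ^ 4, ?_, 2 * x ^ 4 + a * x ^ 2 + 2, ?_⟩)
      · rw [hmem]
        simpa [map_ofNat] using h
      · rw [hmem]
        intro hd
        have hd : 2 * z * (4 * z ^ 2 + a) = 0 := by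
          rw [← hd]
          simp [← hz, map_ofNat]
          ring
        have hd : 4 * z ^ 2 + a = 0 := (mul_eq_zero.1 hd).resolve_left (mul_ne_zero htwo hz0)
        have ha16 : (a ^ 2 - 16 : O ⧸ M) = 0 := by
          linear_combination -8 * h + (4 * z ^ 2 + a) * hd
        have hprod : (((b + 2 - 2 * a) * (b + 2 + 2 * a) : ℤ) : O ⧸ M) = 0 := by
          refine (mul_eq_zero.1 (?_ : (2 : O ⧸ M) ^ 4 * _ = 0)).resolve_left (pow_ne_zero 4 htwo)
          push_cast
          linear_combination (a ^ 2 - 16) * ha16 - (a ^ 2 + 16 + 4 * b + 8) * hW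
        refine hnsq p (mul_dvd_mul ((hcast _).1 hprod) ((hcast _).1 ?_)) rfl
        exact_mod_cast hW
      · rw [hmem]
        simpa [← hz] using ⟨hw0, hz0⟩
      · have hw' : (a ^ 2 - 4 * b + 8 : O) = p * w := by
          exact_mod_cast congrArg (Int.cast : ℤ → O) hw
        simp only [map_add, map_mul, map_pow, map_ofNat, aeval_X, eq_intCast,
          map_intCast]
        linear_combination -4 * hroot - x ^ 4 * hw'
  · have hf : aeval x (X ^ 8 + C a * X ^ 6 + C b * X ^ 4 + C a * X ^ 2 + 1 : ℤ[X]) = 0 := by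
      simpa using hroot
    refine exists_local_generator hx M p hp
      (X ^ 8 + C a * X ^ 6 + C b * X ^ 4 + C a * X ^ 2 + 1) (hf ▸ M.zero_mem) ?_ (Or.inl hf)
    rw [hmem]
    intro hd
    have hd : 8 * z ^ 7 + 6 * a * z ^ 5 + 4 * b * z ^ 3 + 2 * a * z = 0 := by
      rw [← hd]
      simp [← hz, map_ofNat]
      ring
    refine hder ((mul_eq_zero.1 (?_ : (2 : O ⧸ M) * _ = 0)).resolve_left htwo)
    linear_combination z * hd - 4 * hzroot

theorem stmt_0 (a b : ℤ)
    (hmod : (a % 4 = 1 ∧ b % 4 = 3) ∨ (a % 4 = 3 ∧ b % 4 = 1) ∨ (a % 4 = 3 ∧ b % 4 = 3))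
    (hsf : Squarefree ((b + 2 - 2 * a) * (b + 2 + 2 * a) * (a ^ 2 - 4 * b + 8))) :
    IsMonogenic (X ^ 8 + C a * X ^ 6 + C b * X ^ 4 + C a * X ^ 2 + 1) := by
  have ha : a % 2 = 1 := by omega
  have hb : b % 2 = 1 := by omega
  have hab : ¬ (a % 4 = 1 ∧ b % 4 = 1) := by omega
  have hmonic := even_reciprocal_octic_monic a b
  refine ⟨hmonic, (IsPrimitive.Int.irreducible_iff_irreducible_map_cast hmonic.isPrimitive).1
    (even_reciprocal_octic_irreducible a b ha hb hab), fun K _ _ θ hθ htop => ?_⟩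
  have hint : IsIntegral ℤ θ := ⟨_, hmonic, by rwa [← aeval_def]⟩
  refine adjoin_eq_integralClosure_of_isIntegrallyClosed θ hint htop ?_
  let x : Algebra.adjoin ℤ {θ} := ⟨θ, Algebra.self_mem_adjoin_singleton ℤ θ⟩
  have hx : Function.Surjective (aeval x : ℤ[X] →ₐ[ℤ] Algebra.adjoin ℤ {θ}) := by
    rintro ⟨y, hy⟩
    rw [Algebra.adjoin_singleton_eq_range_aeval] at hy
    obtain ⟨h, rfl⟩ := hy
    exact ⟨h, Subtype.ext (by simp [x])⟩
  have hroot : x ^ 8 + a * x ^ 6 + b * x ^ 4 + a * x ^ 2 + 1 = 0 :=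
    Subtype.ext (by simpa [x] using hθ)
  have : IsNoetherianRing (Algebra.adjoin ℤ {θ}) :=
    isNoetherianRing_of_surjective _ _ (aeval x : ℤ[X] →ₐ[ℤ] _).toRingHom hx
  have : Algebra.IsIntegral ℤ (Algebra.adjoin ℤ {θ}) :=
    Algebra.IsIntegral.adjoin (by simpa using hint)
  refine isIntegrallyClosed_of_locally_principal fun M hM₀ _ => ?_
  have : NeZero M := ⟨hM₀⟩
  have : Fact (Ideal.absNorm (M.under ℤ)).Prime := ⟨Nat.absNorm_under_prime M⟩
  exact even_reciprocal_octic_local_generator hx M _ (Int.absNorm_under_mem M) a b ha hb hab hsf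
    hroot
end

section
/- Let a, b ∈ ℤ. The polynomial F(x) = x⁸ + a·x⁴ + b is monogenic with Galois group Gal(F) isomorphic to ℤ/2ℤ × ℤ/4ℤ if and only if a = 0 and b = 1 (i.e., F(x) = x⁸ + 1, the 16th cyclotomic polynomial). -/
open Polynomial

theorem eq_or_of_pow_four_eq {K : Type*} [Field K] {i x y : K} (hi : i ^ 2 = -1)
    (h : y ^ 4 = x ^ 4) : y = x ∨ y = -x ∨ y = i * x ∨ y = -i * x := by
  have : (y - x) * ((y + x) * ((y - i * x) * (y + i * x))) = 0 := by
    linear_combination h + (x ^ 4 - y ^ 2 * x ^ 2) * hi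
  grind

section Automorphisms

variable {K : Type*} [Field K] [Algebra ℚ K] {θ : K} {a b : ℤ}

theorem map_pow_four_eq_or (hθ : θ ^ 8 + a * θ ^ 4 + b = 0) (g : Gal(K/ℚ)) :
    g θ ^ 4 = θ ^ 4 ∨ g θ ^ 4 = -a - θ ^ 4 := by
  have hg := congrArg g hθ
  simp only [map_add, map_mul, map_pow, map_intCast, map_zero] at hg
  have : (g θ ^ 4 - θ ^ 4) * (g θ ^ 4 + a + θ ^ 4) = 0 := by
    linear_combination hg - hθ
  grind

theorem exists_rat_eq_of_fixed [FiniteDimensional ℚ K] [IsGalois ℚ K]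
    (hθ : θ ^ 8 + a * θ ^ 4 + b = 0) {τ : Gal(K/ℚ)} (hτ : τ θ ^ 4 = -a - θ ^ 4) {x : K}
    (hτx : τ x = x) (hx : ∀ g : Gal(K/ℚ), g θ ^ 4 = θ ^ 4 → g x = x) : ∃ q : ℚ, (q : K) = x := by
  suffices x ∈ (⊥ : IntermediateField ℚ K) by
    obtain ⟨q, hq⟩ := IntermediateField.mem_bot.1 this
    exact ⟨q, by simpa using hq⟩
  refine (IsGalois.mem_bot_iff_fixed x).2 fun g ↦ ?_
  rcases map_pow_four_eq_or hθ g with hg | hg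
  · exact hx g hg
  · have h : (τ⁻¹ * g) x = x := hx _ <| τ.injective <| by
      rw [map_pow, map_pow, AlgEquiv.mul_apply, AlgEquiv.aut_inv, AlgEquiv.apply_symm_apply, hg, hτ]
    have h' := congrArg τ h
    rwa [AlgEquiv.mul_apply, AlgEquiv.aut_inv, AlgEquiv.apply_symm_apply, hτx] at h'

/-- In an abelian extension generated by a root `θ` of `x⁸ + a x⁴ + b`, which contains a square
root `i` of `-1`, the existence of an automorphism `θ ↦ iθ` fixing `i` forces `b` and the
discriminant `a² - 4b` to be squares up to sign. -/
theorem exists_sq_of_fixing_root_neg_one [FiniteDimensional ℚ K] [IsGalois ℚ K]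
    (hθ : θ ^ 8 + a * θ ^ 4 + b = 0) (hθ0 : θ ≠ 0)
    (hext : ∀ g h : Gal(K/ℚ), g θ = h θ → g = h) (hcomm : ∀ g h : Gal(K/ℚ), g * h = h * g)
    {i : K} (hi : i ^ 2 = -1) {σ : Gal(K/ℚ)} (hσ : σ θ = i * θ) (hσi : σ i = i) :
    ∃ r s : ℚ, (b = r ^ 2 ∨ b = -r ^ 2) ∧
      ((a : ℚ) ^ 2 - 4 * b = s ^ 2 ∨ (a : ℚ) ^ 2 - 4 * b = -s ^ 2) := by
  have : CharZero K := algebraRat.charZero K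
  have hi0 : i ≠ 0 := by rintro rfl; simp at hi
  obtain ⟨τ, hτi⟩ : ∃ τ : Gal(K/ℚ), τ i = -i := by
    by_contra! hne
    have hmem : i ∈ (⊥ : IntermediateField ℚ K) := by
      refine (IsGalois.mem_bot_iff_fixed i).2 fun g ↦ ?_
      have hg : g i ^ 2 = i ^ 2 := by rw [← map_pow, hi, map_neg, map_one]
      exact (sq_eq_sq_iff_eq_or_eq_neg.1 hg).resolve_right (hne g)
    obtain ⟨q, hq⟩ := IntermediateField.mem_bot.1 hmem
    have : (q : K) ^ 2 = -1 := by rw [← hi, ← hq]; simp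
    have hq' : q ^ 2 = -1 := by exact_mod_cast this
    nlinarith [sq_nonneg q]
  have hστ : σ (τ θ) = -i * τ θ := by
    rw [← AlgEquiv.mul_apply, hcomm, AlgEquiv.mul_apply, hσ, map_mul, hτi]
  have hτθ0 : τ θ ≠ 0 := by simpa using hθ0
  have hfix : ∀ x : K, σ x = x → ∀ g : Gal(K/ℚ), g θ ^ 4 = θ ^ 4 → g x = x := by
    intro x hx g hg
    rcases eq_or_of_pow_four_eq hi hg with h | h | h | h
    · rw [hext g 1 h]; rfl
    · rw [hext g (σ * σ) (by simp only [AlgEquiv.mul_apply, hσ, map_mul, hσi, h]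
                             linear_combination -θ * hi)]
      simp [hx]
    · rw [hext g σ (by rw [h, hσ]), hx]
    · rw [hext g (σ * (σ * σ)) (by simp only [AlgEquiv.mul_apply, hσ, map_mul, hσi, h]
                                   linear_combination -i * θ * hi)]
      simp [hx]
  have hτ : τ θ ^ 4 = -a - θ ^ 4 := by
    refine (map_pow_four_eq_or hθ τ).resolve_left fun h ↦ ?_
    have h2 : (2 : K) * (i * τ θ) = 0 := by
      rcases eq_or_of_pow_four_eq hi h with h | h | h | h <;>
        simp only [h, map_neg, map_mul, hσ, hσi] at hστ <;> grind
    simp [hi0, hθ0] at h2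
  have hσγ : σ (θ * τ θ) = θ * τ θ := by
    rw [map_mul, hσ, hστ]; linear_combination -θ * τ θ * hi
  have hττ : τ (τ θ) ^ 4 = θ ^ 4 := by
    rw [← map_pow, hτ, map_sub, map_neg, map_intCast, map_pow, hτ]; ring
  have hττx : ∀ x, σ x = x → τ (τ x) = x := fun x hx ↦ hfix x hx (τ * τ) hττ
  have hστγ : σ (τ (θ * τ θ)) = τ (θ * τ θ) := by
    rw [← AlgEquiv.mul_apply, hcomm, AlgEquiv.mul_apply, hσγ]
  obtain ⟨r, hr⟩ := exists_rat_eq_of_fixed hθ hτ (x := θ * τ θ * τ (θ * τ θ))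
    (by rw [map_mul, hττx _ hσγ, mul_comm]) (hfix _ (by rw [map_mul, hσγ, hστγ]))
  obtain ⟨s, hs⟩ := exists_rat_eq_of_fixed hθ hτ (x := i * (2 * θ ^ 4 + a))
    (by simp only [map_mul, map_add, map_pow, hτ, hτi, map_intCast, map_ofNat]; ring)
    (hfix _ (by simp only [map_mul, map_add, map_pow, hσ, hσi, map_intCast, map_ofNat]
                linear_combination 2 * i * θ ^ 4 * (i ^ 2 - 1) * hi))
  have hb : (θ * τ θ) ^ 4 = b := by rw [mul_pow, hτ]; linear_combination -hθ
  refine ⟨r, s, ?_, Or.inr ?_⟩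
  · have hsq : (r : K) ^ 2 = b ∨ (r : K) ^ 2 = -b := by
      rw [hr, map_mul τ]
      rcases eq_or_of_pow_four_eq hi hττ with h | h | h | h <;> rw [h]
      · left; linear_combination hb
      · left; linear_combination hb
      · right; linear_combination -hb + (θ * τ θ) ^ 4 * hi
      · right; linear_combination -hb + (θ * τ θ) ^ 4 * hi
    rcases hsq with h | h
    · left; exact_mod_cast h.symm
    · right
      have : (b : K) = -(r : K) ^ 2 := by rw [h, neg_neg]
      exact_mod_cast this
  · have : (a : K) ^ 2 - 4 * b = -(s : K) ^ 2 := by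
      rw [hs]; linear_combination -4 * hθ + (2 * θ ^ 4 + a) ^ 2 * hi
    exact_mod_cast this

/-- The counterpart of `exists_sq_of_fixing_root_neg_one` when every automorphism `θ ↦ ± iθ`
negates `i`: here the conclusion needs an automorphism `τ` with `τ² ≠ 1`. -/
theorem exists_sq_of_negating_root_neg_one [FiniteDimensional ℚ K] [IsGalois ℚ K]
    (hθ : θ ^ 8 + a * θ ^ 4 + b = 0)
    (hext : ∀ g h : Gal(K/ℚ), g θ = h θ → g = h) (hcomm : ∀ g h : Gal(K/ℚ), g * h = h * g)
    {i : K} (hi : i ^ 2 = -1) {σ : Gal(K/ℚ)} (hσ : σ θ = i * θ)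
    (hneg : ∀ g : Gal(K/ℚ), g θ = i * θ ∨ g θ = -i * θ → g i = -i)
    {τ : Gal(K/ℚ)} (hτ2 : τ * τ ≠ 1) :
    ∃ r s : ℚ, b = r ^ 2 ∧ (r * ((a : ℚ) ^ 2 - 4 * b) = s ^ 2 ∨
      r * ((a : ℚ) ^ 2 - 4 * b) = -s ^ 2) := by
  have : CharZero K := algebraRat.charZero K
  have hi0 : i ≠ 0 := by rintro rfl; simp at hi
  have hine : i ≠ -i := by
    intro h
    have : 2 * i = 0 := by linear_combination h
    simp [hi0] at this
  have hσi : σ i = -i := hneg σ (Or.inl hσ)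
  have hτi : τ i = i ∨ τ i = -i :=
    sq_eq_sq_iff_eq_or_eq_neg.1 (by rw [← map_pow, hi, map_neg, map_one])
  have hτ : τ θ ^ 4 = -a - θ ^ 4 := by
    refine (map_pow_four_eq_or hθ τ).resolve_left fun h ↦ hτ2 (hext _ _ ?_)
    rw [AlgEquiv.mul_apply, AlgEquiv.one_apply]
    rcases eq_or_of_pow_four_eq hi h with h | h | h | h
    · rw [h, h]
    · rw [h, map_neg, h, neg_neg]
    · rw [h, map_mul, h, hneg τ (Or.inl h)]; linear_combination -θ * hi
    · rw [h, map_mul, map_neg, h, hneg τ (Or.inr h)]; linear_combination -θ * hi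
  have hττ4 : τ (τ θ) ^ 4 = θ ^ 4 := by
    rw [← map_pow, hτ, map_sub, map_neg, map_intCast, map_pow, hτ]; ring
  have hττi : (τ * τ) i ≠ -i := by
    rw [AlgEquiv.mul_apply]
    rcases hτi with h | h <;> simp [h, hine]
  have hττ : τ (τ θ) = -θ := by
    rcases eq_or_of_pow_four_eq hi hττ4 with h | h | h | h
    · exact absurd (hext (τ * τ) 1 h) hτ2
    · exact h
    · exact absurd (hneg (τ * τ) (Or.inl h)) hττi
    · exact absurd (hneg (τ * τ) (Or.inr h)) hττi
  have hfix : ∀ x : K, σ x = x → τ x = x → ∀ g : Gal(K/ℚ), g θ ^ 4 = θ ^ 4 → g x = x := by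
    intro x hx hx' g hg
    rcases eq_or_of_pow_four_eq hi hg with h | h | h | h
    · rw [hext g 1 h]; rfl
    · rw [hext g (τ * τ) (by rw [h, AlgEquiv.mul_apply, hττ])]
      simp [hx']
    · rw [hext g σ (by rw [h, hσ]), hx]
    · rw [hext g (σ * (τ * τ))
        (by rw [h, AlgEquiv.mul_apply, AlgEquiv.mul_apply, hττ, map_neg, hσ, neg_mul])]
      simp [hx, hx']
  have hστ : σ (τ θ) = τ i * τ θ := by
    rw [← AlgEquiv.mul_apply, hcomm, AlgEquiv.mul_apply, hσ, map_mul]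
  have hτi2 : τ i ^ 2 = -1 := by rw [← map_pow, hi, map_neg, map_one]
  have hb : (θ * τ θ) ^ 4 = b := by rw [mul_pow, hτ]; linear_combination -hθ
  have hτγ : τ (θ * τ θ) = -(θ * τ θ) := by rw [map_mul, hττ]; ring
  have hσ4 : (i * θ) ^ 4 = θ ^ 4 := by linear_combination θ ^ 4 * (i ^ 2 - 1) * hi
  obtain ⟨r, hr⟩ := exists_rat_eq_of_fixed hθ hτ (x := (θ * τ θ) ^ 2)
    (by rw [map_pow, hτγ, neg_sq])
    (hfix _ (by rw [map_pow, map_mul, hσ, hστ]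
                linear_combination (θ * τ θ) ^ 2 * (τ i ^ 2 * hi - hτi2))
      (by rw [map_pow, hτγ, neg_sq]))
  have hrb : (b : ℚ) = r ^ 2 := by
    have : (b : K) = (r : K) ^ 2 := by rw [hr, ← hb]; ring
    exact_mod_cast this
  have hτδ : τ (2 * θ ^ 4 + a) = -(2 * θ ^ 4 + a) := by
    simp only [map_mul, map_add, map_pow, hτ, map_intCast, map_ofNat]; ring
  have hσδ : σ (2 * θ ^ 4 + a) = 2 * θ ^ 4 + a := by
    simp only [map_mul, map_add, map_pow, hσ, map_intCast, map_ofNat]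
    rw [hσ4]
  rcases hτi with hτi | hτi
  · have hσx : σ (i * (θ * τ θ * (2 * θ ^ 4 + a))) = i * (θ * τ θ * (2 * θ ^ 4 + a)) := by
      rw [map_mul, map_mul, map_mul, hσδ, hστ, hσ, hσi, hτi]
      linear_combination -i * (θ * τ θ * (2 * θ ^ 4 + a)) * hi
    have hτx : τ (i * (θ * τ θ * (2 * θ ^ 4 + a))) = i * (θ * τ θ * (2 * θ ^ 4 + a)) := by
      rw [map_mul, map_mul, hτγ, hτδ, hτi]; ring
    obtain ⟨s, hs⟩ := exists_rat_eq_of_fixed hθ hτ hτx (hfix _ hσx hτx)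
    refine ⟨r, s, hrb, Or.inr ?_⟩
    have : (r : K) * ((a : K) ^ 2 - 4 * b) = -(s : K) ^ 2 := by
      rw [hs, hr]
      linear_combination (θ * τ θ) ^ 2 * (-4 * hθ + (2 * θ ^ 4 + a) ^ 2 * hi)
    exact_mod_cast this
  · have hσx : σ (θ * τ θ * (2 * θ ^ 4 + a)) = θ * τ θ * (2 * θ ^ 4 + a) := by
      rw [map_mul, map_mul, hσδ, hστ, hσ, hτi]
      linear_combination -(θ * τ θ * (2 * θ ^ 4 + a)) * hi
    have hτx : τ (θ * τ θ * (2 * θ ^ 4 + a)) = θ * τ θ * (2 * θ ^ 4 + a) := by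
      rw [map_mul, hτγ, hτδ]; ring
    obtain ⟨s, hs⟩ := exists_rat_eq_of_fixed hθ hτ hτx (hfix _ hσx hτx)
    refine ⟨r, s, hrb, Or.inl ?_⟩
    have : (r : K) * ((a : K) ^ 2 - 4 * b) = (s : K) ^ 2 := by
      rw [hs, hr]
      linear_combination (θ * τ θ) ^ 2 * (-4 * hθ)
    exact_mod_cast this

end Automorphisms

theorem natDegree_octic {R : Type*} [CommRing R] [Nontrivial R] (a b : R) :
    (X ^ 8 + C a * X ^ 4 + C b : R[X]).natDegree = 8 := by
  compute_degree!

theorem monic_octic {R : Type*} [CommRing R] (a b : R) :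
    (X ^ 8 + C a * X ^ 4 + C b : R[X]).Monic := by
  monicity!

/-- If `ℤ[θ]` is the maximal order for a root `θ` of `x⁸ + a x⁴ + b`, then `b` is squarefree. -/
theorem isUnit_of_sq_dvd_of_adjoin_eq {K : Type*} [Field K] [CharZero K] {θ : K} {a b N : ℤ}
    (hroot : aeval θ (X ^ 8 + C a * X ^ 4 + C b : ℤ[X]) = 0) (hb : b ≠ 0)
    (hirr : Irreducible ((X ^ 8 + C a * X ^ 4 + C b : ℤ[X]).map (Int.castRingHom ℚ)))
    (hadj : Algebra.adjoin ℤ {θ} = integralClosure ℤ K) (hN : N ^ 2 ∣ b) : IsUnit N := by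
  obtain ⟨c, rfl⟩ := hN
  have hN0 : (N : K) ≠ 0 := by rintro h; simp_all
  set F : ℤ[X] := X ^ 8 + C a * X ^ 4 + C (N ^ 2 * c) with hF
  have hFm : F.Monic := monic_octic _ _
  have hFd : F.natDegree = 8 := natDegree_octic _ _
  have hθ : θ ^ 8 + a * θ ^ 4 + N ^ 2 * c = 0 := by simpa [hF] using hroot
  have hθ0 : θ ≠ 0 := by
    rintro rfl
    apply hb
    have : ((N ^ 2 * c : ℤ) : K) = 0 := by push_cast; simpa using hθ
    exact_mod_cast this
  obtain ⟨α, hα⟩ : ∃ α : K, N * α = -(θ ^ 7 + a * θ ^ 3) := ⟨_, mul_div_cancel₀ _ hN0⟩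
  have hαθ : α * θ = N * c := by
    refine mul_left_cancel₀ hN0 ?_
    linear_combination θ * hα - hθ
  have hint : IsIntegral ℤ α := by
    refine ⟨X ^ 8 + C (a * N ^ 2 * c ^ 3) * X ^ 4 + C (N ^ 6 * c ^ 7), monic_octic _ _, ?_⟩
    simp only [eval₂_add, eval₂_mul, eval₂_pow, eval₂_X, eval₂_C, map_mul, map_pow,
      algebraMap_int_eq, Int.coe_castRingHom]
    refine (mul_eq_zero.1 ?_).resolve_left (pow_ne_zero 8 hθ0)
    calc _ = (α * θ) ^ 8 + a * N ^ 2 * c ^ 3 * θ ^ 4 * (α * θ) ^ 4 + N ^ 6 * c ^ 7 * θ ^ 8 := by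
          ring
      _ = _ := by rw [hαθ]; linear_combination (N : K) ^ 6 * c ^ 7 * hθ
  have hmem : α ∈ Algebra.adjoin ℤ {θ} := hadj ▸ hint
  rw [Algebra.adjoin_singleton_eq_range_aeval] at hmem
  obtain ⟨p, hp⟩ := hmem
  have hpθ : aeval θ (p %ₘ F) = α := by
    rw [← hp]
    conv_rhs => rw [← modByMonic_add_div p F]
    simp [hroot]
  set q : ℤ[X] := p %ₘ F
  have hqd : q.natDegree < 8 := hFd ▸ natDegree_modByMonic_lt p hFm (by
    intro h; rw [h] at hFd; simp at hFd)
  set Q : ℤ[X] := C N * q + (X ^ 7 + C a * X ^ 3) with hQ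
  have hQd : Q.natDegree < 8 := by
    refine (natDegree_add_le _ _).trans_lt (max_lt ?_ ?_)
    · exact (natDegree_C_mul_le _ _).trans_lt hqd
    · refine lt_of_le_of_lt (b := 7) ?_ (by norm_num)
      compute_degree!
  have hQ0 : Q = 0 := by
    have hmin := minpoly.eq_of_irreducible_of_monic hirr
      (by rw [← hroot, ← algebraMap_int_eq ℚ, aeval_map_algebraMap]) (hFm.map _)
    have hdvd : F.map (Int.castRingHom ℚ) ∣ Q.map (Int.castRingHom ℚ) := by
      rw [hmin]
      refine minpoly.dvd ℚ θ ?_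
      rw [← algebraMap_int_eq ℚ, aeval_map_algebraMap, hQ]
      simp only [map_add, map_mul, map_pow, aeval_X, hpθ, aeval_C, algebraMap_int_eq,
        Int.coe_castRingHom]
      linear_combination hα
    refine Polynomial.map_injective _ (RingHom.injective_int (Int.castRingHom ℚ)) ?_
    rw [Polynomial.map_zero]
    refine eq_zero_of_dvd_of_natDegree_lt hdvd ?_
    rw [hFm.natDegree_map, hFd]
    exact natDegree_map_le.trans_lt hQd
  have hcoeff := congrArg (coeff · 7) hQ0
  simp only [hQ, coeff_add, coeff_C_mul, coeff_X_pow, coeff_zero] at hcoeff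
  norm_num at hcoeff
  exact isUnit_of_dvd_one ⟨-q.coeff 7, by linear_combination hcoeff⟩

theorem exists_int_eq_of_sq {q : ℚ} {n : ℤ} (h : (n : ℚ) = q ^ 2 ∨ (n : ℚ) = -q ^ 2) :
    ∃ m : ℤ, (m : ℚ) = q := by
  have hint : IsIntegral ℤ q := by
    refine IsIntegral.of_pow two_pos ?_
    rcases h with h | h
    · rw [← h]; exact isIntegral_algebraMap (R := ℤ) (x := n)
    · rw [← neg_neg (q ^ 2), ← h]; exact (isIntegral_algebraMap (R := ℤ) (x := n)).neg
  obtain ⟨m, hm⟩ := IsIntegrallyClosed.isIntegral_iff.1 hint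
  exact ⟨m, by simpa using hm⟩

theorem eq_of_sq_sub_four_mul_eq {a b s : ℤ} (hb : b = 1 ∨ b = -1)
    (hs : a ^ 2 - 4 * b = s ^ 2 ∨ a ^ 2 - 4 * b = -s ^ 2) :
    a = 0 ∧ (b = 1 ∨ b = -1) ∨ b = 1 ∧ (a = 2 ∨ a = -2) := by
  have key : ∀ x y : ℤ, x ^ 2 = y ^ 2 + 4 → y = 0 := by
    intro x y h
    wlog hx : 0 ≤ x generalizing x
    · exact this (-x) (by linarith [neg_sq x]) (by omega)
    wlog hy : 0 ≤ y generalizing y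
    · have := this (-y) (by linarith [neg_sq y]) (by omega)
      omega
    have h1 : x < y + 3 := by nlinarith
    have h2 : y < x := by nlinarith
    obtain rfl | rfl : x = y + 1 ∨ x = y + 2 := by omega
    · have : 2 * y = 3 := by linarith [add_sq y 1]
      omega
    · linarith [add_sq y 2]
  have key' : ∀ x : ℤ, x ^ 2 + s ^ 2 = 4 → x = 0 ∨ x = 2 ∨ x = -2 := by
    intro x h
    have h1 : x ≤ 2 := by nlinarith [sq_nonneg s]
    have h2 : -2 ≤ x := by nlinarith [sq_nonneg s]
    have h3 : s ≤ 2 := by nlinarith [sq_nonneg x]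
    have h4 : -2 ≤ s := by nlinarith [sq_nonneg x]
    interval_cases x <;> interval_cases s <;> omega
  rcases hb with rfl | rfl <;> rcases hs with h | h
  · have hs0 := key a s (by linarith)
    have : (a - 2) * (a + 2) = 0 := by rw [hs0] at h; linear_combination h
    rcases mul_eq_zero.1 this with h | h <;> omega
  · rcases key' a (by linarith) with h | h | h <;> simp [h]
  · simp [key s a (by linarith)]
  · nlinarith [sq_nonneg a, sq_nonneg s]

theorem not_irreducible_X_pow_eight_sub_one :
    ¬ Irreducible ((X ^ 8 + C 0 * X ^ 4 + C (-1) : ℤ[X]).map (Int.castRingHom ℚ)) := by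
  intro h
  have hroot : IsRoot ((X ^ 8 + C 0 * X ^ 4 + C (-1) : ℤ[X]).map (Int.castRingHom ℚ)) 1 := by
    simp
  have := natDegree_eq_of_degree_eq_some (degree_eq_one_of_irreducible_of_root h hroot)
  rw [(monic_octic _ _).natDegree_map, natDegree_octic] at this
  norm_num at this

theorem not_irreducible_octic_square (c : ℤ) :
    ¬ Irreducible ((X ^ 8 + C (2 * c) * X ^ 4 + C (c ^ 2) : ℤ[X]).map (Int.castRingHom ℚ)) := by
  intro h
  have hsq : (X ^ 8 + C (2 * c) * X ^ 4 + C (c ^ 2) : ℤ[X]).map (Int.castRingHom ℚ) =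
      (X ^ 4 + C (c : ℚ)) ^ 2 := by
    simp only [Polynomial.map_add, Polynomial.map_mul, Polynomial.map_pow, map_X, map_C,
      map_mul, map_pow, map_ofNat, Polynomial.map_ofNat, Int.coe_castRingHom]
    ring
  rw [hsq] at h
  exact not_irreducible_pow (by norm_num) h

/-- The isomorphism `(ℤ/16)ˣ ≃ ℤ/2 × ℤ/4` inverse to `(x, y) ↦ (-1)ˣ 3ʸ`. -/
noncomputable def unitsZModSixteenEquiv :
    (ZMod 16)ˣ ≃* Multiplicative (ZMod 2) × Multiplicative (ZMod 4) :=
  (MulEquiv.ofBijective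
    (MonoidHom.mk' (fun x : Multiplicative (ZMod 2) × Multiplicative (ZMod 4) ↦
        (-1 : (ZMod 16)ˣ) ^ x.1.toAdd.val *
          (⟨3, 11, by decide, by decide⟩ : (ZMod 16)ˣ) ^ x.2.toAdd.val)
      (by decide))
    (by decide)).symm

theorem cyclotomic_sixteen (R : Type*) [CommRing R] : cyclotomic 16 R = X ^ 8 + 1 := by
  have := cyclotomic_prime_pow_eq_geom_sum (R := R) (n := 3) Nat.prime_two
  norm_num [Finset.sum_range_succ] at this
  rw [this, add_comm]

theorem map_octic_zero_one :
    (X ^ 8 + C 0 * X ^ 4 + C 1 : ℤ[X]).map (Int.castRingHom ℚ) = cyclotomic 16 ℚ := by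
  simp [cyclotomic_sixteen]

theorem isMonogenic_X_pow_eight_add_one : IsMonogenic (X ^ 8 + C 0 * X ^ 4 + C 1) := by
  refine ⟨monic_octic _ _, ?_, fun K _ _ θ hθ htop ↦ ?_⟩
  · rw [map_octic_zero_one]; exact cyclotomic.irreducible_rat (by norm_num)
  have hprim : IsPrimitiveRoot θ (2 ^ 4) := by
    rw [← isRoot_cyclotomic_iff_charZero (by norm_num)]
    norm_num [cyclotomic_sixteen]
    simpa using hθ
  have : IsCyclotomicExtension {2 ^ 4} ℚ K := by
    rw [IsCyclotomicExtension.iff_singleton]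
    refine ⟨⟨θ, hprim⟩, fun x ↦ ?_⟩
    refine Algebra.adjoin_mono ?_ (htop ▸ Algebra.mem_top : x ∈ Algebra.adjoin ℚ {θ})
    simpa using hprim.pow_eq_one
  have hcl := IsCyclotomicExtension.Rat.isIntegralClosure_adjoin_singleton_of_prime_pow hprim
  ext x
  rw [mem_integralClosure_iff, hcl.isIntegral_iff]
  exact ⟨fun hx ↦ ⟨⟨x, hx⟩, rfl⟩, fun ⟨y, hy⟩ ↦ hy ▸ y.2⟩

theorem nonempty_gal_X_pow_eight_add_one :
    Nonempty (((X ^ 8 + C 0 * X ^ 4 + C 1 : ℤ[X]).map (Int.castRingHom ℚ)).Gal ≃*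
      Multiplicative (ZMod 2) × Multiplicative (ZMod 4)) := by
  rw [map_octic_zero_one]
  have : IsCyclotomicExtension {16} ℚ (CyclotomicField 16 ℚ) :=
    CyclotomicField.isCyclotomicExtension 16 ℚ
  exact ⟨(galCyclotomicEquivUnitsZMod (L := CyclotomicField 16 ℚ)
    (cyclotomic.irreducible_rat (by norm_num))).trans unitsZModSixteenEquiv⟩

theorem exists_sq_eq_neg_one_of_splits {K : Type*} [Field K] {θ a b : K} (hθ0 : θ ≠ 0)
    (hθ : θ ^ 8 + a * θ ^ 4 + b = 0) (hsplit : (X ^ 8 + C a * X ^ 4 + C b : K[X]).Splits) :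
    ∃ i : K, i ^ 2 = -1 := by
  have hfac : (X ^ 8 + C a * X ^ 4 + C b : K[X]) =
      (X ^ 2 + C (θ ^ 2)) * ((X ^ 2 - C (θ ^ 2)) * (X ^ 4 + C (θ ^ 4 + a))) := by
    rw [show b = -θ ^ 8 - a * θ ^ 4 by linear_combination hθ]
    simp only [map_add, map_sub, map_mul, map_neg, map_pow]
    ring
  have hdeg : (X ^ 2 + C (θ ^ 2) : K[X]).degree = 2 := by compute_degree!
  obtain ⟨y, hy⟩ := (hsplit.of_dvd (monic_octic a b).ne_zero ⟨_, hfac⟩).exists_eval_eq_zero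
    (by rw [hdeg]; norm_num)
  refine ⟨y / θ, ?_⟩
  simp only [eval_add, eval_pow, eval_X, eval_C] at hy
  field_simp
  linear_combination hy

theorem eq_of_isMonogenic_of_gal {a b : ℤ} (hmono : IsMonogenic (X ^ 8 + C a * X ^ 4 + C b))
    {K : Type} [Field K] [inst : Algebra ℚ K]
    [IsSplittingField ℚ K ((X ^ 8 + C a * X ^ 4 + C b : ℤ[X]).map (Int.castRingHom ℚ))]
    (e : Gal(K/ℚ) ≃* Multiplicative (ZMod 2) × Multiplicative (ZMod 4)) : a = 0 ∧ b = 1 := by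
  have : CharZero K := algebraRat.charZero K
  obtain rfl : inst = DivisionRing.toRatAlgebra := Subsingleton.elim _ _
  have : FiniteDimensional ℚ K := IsSplittingField.finiteDimensional K
    ((X ^ 8 + C a * X ^ 4 + C b : ℤ[X]).map (Int.castRingHom ℚ))
  have : NumberField K := {}
  obtain ⟨-, hirr, hint⟩ := hmono
  set f : ℚ[X] := (X ^ 8 + C a * X ^ 4 + C b : ℤ[X]).map (Int.castRingHom ℚ) with hf
  have hfm : f.Monic := (monic_octic a b).map _
  have hfd : f.natDegree = 8 := by rw [(monic_octic a b).natDegree_map, natDegree_octic]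
  have : IsGalois ℚ K := IsGalois.of_separable_splitting_field (p := f) hirr.separable
  have hcomm (g h : Gal(K/ℚ)) : g * h = h * g := e.injective (by rw [map_mul, map_mul, mul_comm])
  have hrank : Module.finrank ℚ K = 8 := by
    rw [← IsGalois.card_aut_eq_finrank, Nat.card_congr e.toEquiv, Nat.card_prod]
    simp
  obtain ⟨θ, hθf⟩ : ∃ θ : K, aeval θ f = 0 := by
    obtain ⟨θ, h⟩ := (IsSplittingField.splits K f).exists_eval_eq_zero
      (by rw [degree_map]; exact (degree_pos_of_irreducible hirr).ne')
    exact ⟨θ, by rwa [← eval_map_algebraMap]⟩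
  have hmin : f = minpoly ℚ θ := minpoly.eq_of_irreducible_of_monic hirr hθf hfm
  have hroot : aeval θ (X ^ 8 + C a * X ^ 4 + C b : ℤ[X]) = 0 := by
    rw [← hθf, hf, ← algebraMap_int_eq ℚ, aeval_map_algebraMap]
  have hθ : θ ^ 8 + a * θ ^ 4 + b = 0 := by simpa using hroot
  have hb0 : b ≠ 0 := by
    rintro rfl
    have h0 : f.IsRoot 0 := by simp [hf, IsRoot]
    have := natDegree_eq_of_degree_eq_some (degree_eq_one_of_irreducible_of_root hirr h0)
    rw [hfd] at this
    norm_num at this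
  have hθ0 : θ ≠ 0 := by
    rintro rfl
    exact hb0 (by exact_mod_cast (by simpa using hθ : (b : K) = 0))
  have hint_θ : IsIntegral ℚ θ := Algebra.IsIntegral.isIntegral θ
  have htopF : IntermediateField.adjoin ℚ {θ} = ⊤ := by
    refine IntermediateField.eq_of_le_of_finrank_eq le_top ?_
    rw [IntermediateField.adjoin.finrank hint_θ, ← hmin, hfd, IntermediateField.finrank_top', hrank]
  have htop : Algebra.adjoin ℚ {θ} = (⊤ : Subalgebra ℚ K) := by
    rw [← IntermediateField.adjoin_simple_toSubalgebra_of_isAlgebraic hint_θ.isAlgebraic, htopF,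
      IntermediateField.top_toSubalgebra]
  have hext (g h : Gal(K/ℚ)) (hgh : g θ = h θ) : g = h := by
    have : (g : K →ₐ[ℚ] K) = h := AlgHom.ext_of_adjoin_eq_top htop (by simpa using hgh)
    exact AlgEquiv.ext fun x ↦ DFunLike.congr_fun this x
  obtain ⟨i, hi⟩ := exists_sq_eq_neg_one_of_splits hθ0 hθ (by
    have := IsSplittingField.splits K f
    rwa [hf, Polynomial.map_map, show (X ^ 8 + C a * X ^ 4 + C b : ℤ[X]).map
      ((algebraMap ℚ K).comp (Int.castRingHom ℚ)) = X ^ 8 + C (a : K) * X ^ 4 + C (b : K) by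
        simp] at this)
  have htrans (y : K) (hy : y ^ 4 = θ ^ 4) : ∃ g : Gal(K/ℚ), g θ = y := by
    refine minpoly.exists_algEquiv_of_root' hint_θ.isAlgebraic ?_
    rw [← hmin, hf, ← algebraMap_int_eq ℚ, aeval_map_algebraMap]
    simp only [map_add, map_mul, map_pow, aeval_X, aeval_C, algebraMap_int_eq, Int.coe_castRingHom]
    linear_combination hθ + (y ^ 4 + θ ^ 4 + a) * hy
  obtain ⟨σ, hσ⟩ := htrans (i * θ) (by linear_combination θ ^ 4 * (i ^ 2 - 1) * hi)
  obtain ⟨r, s, hr, hs⟩ : ∃ r s : ℚ, (b = r ^ 2 ∨ b = -r ^ 2) ∧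
      (r ^ 2 = 1 → (a : ℚ) ^ 2 - 4 * b = s ^ 2 ∨ (a : ℚ) ^ 2 - 4 * b = -s ^ 2) := by
    by_cases hneg : ∀ g : Gal(K/ℚ), g θ = i * θ ∨ g θ = -i * θ → g i = -i
    · obtain ⟨τ, hτ⟩ : ∃ τ : Gal(K/ℚ), τ * τ ≠ 1 := by
        refine ⟨e.symm (1, Multiplicative.ofAdd (1 : ZMod 4)), fun h ↦ ?_⟩
        have := congrArg e h
        rw [map_mul, MulEquiv.apply_symm_apply, map_one e] at this
        exact absurd this (by decide)
      obtain ⟨r, s, hr, hs⟩ := exists_sq_of_negating_root_neg_one hθ hext hcomm hi hσ hneg hτ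
      refine ⟨r, s, Or.inl hr, fun h1 ↦ ?_⟩
      rcases sq_eq_sq_iff_eq_or_eq_neg.1 (h1.trans (one_pow 2).symm) with rfl | rfl
      · simpa using hs
      · rcases hs with hs | hs
        · right; linarith
        · left; linarith
    · push Not at hneg
      obtain ⟨g, hg, hgi⟩ := hneg
      have hgi : g i = i := (sq_eq_sq_iff_eq_or_eq_neg.1
        (by rw [← map_pow, hi, map_neg, map_one])).resolve_right hgi
      obtain ⟨r, s, hr, hs⟩ : ∃ r s : ℚ, (b = r ^ 2 ∨ b = -r ^ 2) ∧
          ((a : ℚ) ^ 2 - 4 * b = s ^ 2 ∨ (a : ℚ) ^ 2 - 4 * b = -s ^ 2) := by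
        rcases hg with hg | hg
        · exact exists_sq_of_fixing_root_neg_one hθ hθ0 hext hcomm hi hg hgi
        · exact exists_sq_of_fixing_root_neg_one hθ hθ0 hext hcomm
            (i := -i) (by rw [neg_sq, hi]) hg (by rw [map_neg, hgi])
      exact ⟨r, s, hr, fun _ ↦ hs⟩
  obtain ⟨N, rfl⟩ := exists_int_eq_of_sq hr
  have hr : b = N ^ 2 ∨ b = -N ^ 2 := by exact_mod_cast hr
  have hN : N ^ 2 = 1 := by
    have hdvd : N ^ 2 ∣ b := by rcases hr with h | h <;> simp [h]
    rw [← Int.natAbs_sq, Int.isUnit_iff_natAbs_eq.1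
      (isUnit_of_sq_dvd_of_adjoin_eq hroot hb0 hirr (hint K θ hroot htop) hdvd)]
    norm_num
  have hs := hs (by exact_mod_cast hN)
  obtain ⟨S, rfl⟩ := exists_int_eq_of_sq (n := a ^ 2 - 4 * b) (by push_cast; exact hs)
  rw [hN] at hr
  rcases eq_of_sq_sub_four_mul_eq hr (by exact_mod_cast hs) with
    ⟨rfl, rfl | rfl⟩ | ⟨rfl, rfl | rfl⟩
  · exact ⟨rfl, rfl⟩
  · exact absurd hirr not_irreducible_X_pow_eight_sub_one
  · exact absurd hirr (by simpa [hf] using not_irreducible_octic_square 1)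
  · exact absurd hirr (by simpa [hf] using not_irreducible_octic_square (-1))

theorem stmt_6 (a b : ℤ) :
    (IsMonogenic (X ^ 8 + C a * X ^ 4 + C b) ∧
      Nonempty ((((X ^ 8 + C a * X ^ 4 + C b : Polynomial ℤ).map (Int.castRingHom ℚ)).Gal ≃*
        Multiplicative (ZMod 2) × Multiplicative (ZMod 4)))) ↔
    (a = 0 ∧ b = 1) := by
  constructor
  · rintro ⟨hmono, ⟨e⟩⟩
    exact eq_of_isMonogenic_of_gal hmono e
  · rintro ⟨rfl, rfl⟩
    exact ⟨isMonogenic_X_pow_eight_add_one, nonempty_gal_X_pow_eight_add_one⟩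
end

section
/- Let a, b ∈ ℤ. The polynomial F(x) = x⁸ + a·x⁴ + b is monogenic with Galois group Gal(F) isomorphic to the dihedral group of order 8 if and only if a = 3 and b = 1 (i.e., F(x) = x⁸ + 3x⁴ + 1). -/
open Polynomial

/-- The polynomial `X⁸ + a X⁴ + b` over `ℤ`. -/
noncomputable abbrev octic (a b : ℤ) : ℤ[X] := X ^ 8 + C a * X ^ 4 + C b

/-- The polynomial `X⁸ + a X⁴ + b` with its coefficients cast to `ℚ`. -/
noncomputable abbrev octicRat (a b : ℤ) : ℚ[X] := (octic a b).map (Int.castRingHom ℚ)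

lemma octic_monic (a b : ℤ) : (octic a b).Monic := by
  unfold octic; monicity!

lemma octic_natDegree (a b : ℤ) : (octic a b).natDegree = 8 := by
  unfold octic; compute_degree!

lemma aeval_octic {A : Type*} [CommRing A] (a b : ℤ) (x : A) :
    aeval x (octic a b) = x ^ 8 + a * x ^ 4 + b := by
  simp [octic]

lemma aeval_octicRat {A : Type*} [CommRing A] [Algebra ℚ A] (a b : ℤ) (x : A) :
    aeval x (octicRat a b) = x ^ 8 + a * x ^ 4 + b := by
  simp [octicRat, octic]

/-- In a field, the fourth roots of `y ^ 4` are the `i ^ k * y`. -/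
lemma eq_of_pow_four_eq {K : Type*} [Field K] {i x y : K} (hi : i ^ 2 = -1)
    (h : x ^ 4 = y ^ 4) : x = y ∨ x = -y ∨ x = i * y ∨ x = -(i * y) := by
  have : (x - y) * ((x + y) * ((x - i * y) * (x + i * y))) = 0 := by
    linear_combination h - (x ^ 2 - y ^ 2) * y ^ 2 * hi
  rcases mul_eq_zero.1 this with h | h
  · exact Or.inl (sub_eq_zero.1 h)
  rcases mul_eq_zero.1 h with h | h
  · exact Or.inr (Or.inl (eq_neg_of_add_eq_zero_left h))
  rcases mul_eq_zero.1 h with h | h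
  · exact Or.inr (Or.inr (Or.inl (sub_eq_zero.1 h)))
  · exact Or.inr (Or.inr (Or.inr (eq_neg_of_add_eq_zero_left h)))

lemma map_sq_eq_neg_one {K : Type*} [Field K] [Algebra ℚ K] {i : K} (hi : i ^ 2 = -1)
    (σ : K ≃ₐ[ℚ] K) : σ i = i ∨ σ i = -i := by
  apply sq_eq_sq_iff_eq_or_eq_neg.1
  rw [← map_pow, hi, map_neg, map_one]

lemma isIntegral_of_root {K : Type*} [Field K] {a b : ℤ} {θ : K}
    (hθ : θ ^ 8 + a * θ ^ 4 + b = 0) : IsIntegral ℤ θ :=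
  ⟨octic a b, octic_monic a b, by rw [← aeval_def, aeval_octic, hθ]⟩

lemma isIntegral_of_sq_eq_neg_one {K : Type*} [Field K] {i : K} (hi : i ^ 2 = -1) :
    IsIntegral ℤ i :=
  IsIntegral.of_pow two_pos (hi ▸ isIntegral_one.neg)

section Octic

variable {K : Type*} [Field K] [NumberField K] {a b : ℤ} {θ : K}

lemma minpoly_eq_octicRat (hirr : Irreducible (octicRat a b))
    (hθ : θ ^ 8 + a * θ ^ 4 + b = 0) : minpoly ℚ θ = octicRat a b :=
  (minpoly.eq_of_irreducible_of_monic hirr (by rw [aeval_octicRat, hθ])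
    ((octic_monic a b).map _)).symm

/-- If `m • z` is a polynomial expression of degree less than `8` in `θ` and `z ∈ ℤ[θ]`, then `m`
divides every coefficient of that expression. -/
lemma dvd_coeff_of_mem_adjoin (hirr : Irreducible (octicRat a b))
    (hθ : θ ^ 8 + a * θ ^ 4 + b = 0) {m : ℤ} {z : K} (hz : z ∈ Algebra.adjoin ℤ {θ})
    {g : ℤ[X]} (hg : g.natDegree < 8) (h : m * z = aeval θ g) (k : ℕ) : m ∣ g.coeff k := by
  rw [Algebra.adjoin_singleton_eq_range_aeval] at hz
  obtain ⟨p, rfl⟩ := hz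
  have hr : aeval θ (p %ₘ octic a b) = aeval θ p := by
    apply aeval_modByMonic_eq_self_of_root (by rw [aeval_octic, hθ])
  set r := p %ₘ octic a b with hrdef
  have hdeg : (C m * r - g).degree < 8 := by
    have h1 : r.degree < 8 := by
      have := degree_modByMonic_lt p (octic_monic a b)
      rwa [degree_eq_natDegree (octic_monic a b).ne_zero, octic_natDegree] at this
    have h2 : g.degree < 8 := lt_of_le_of_lt degree_le_natDegree (by exact_mod_cast hg)
    refine lt_of_le_of_lt (degree_sub_le _ _) (max_lt (lt_of_le_of_lt ?_ h1) h2)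
    rw [degree_mul]
    exact le_trans (add_le_add_left degree_C_le _) (by simp)
  have hzero : C m * r - g = 0 := by
    have h0 : aeval θ ((C m * r - g).map (Int.castRingHom ℚ)) = 0 := by
      have := aeval_map_algebraMap ℚ θ (C m * r - g)
      rw [algebraMap_int_eq] at this
      rw [this, map_sub, map_mul, hr, ← h]
      simp
    have h1 := minpoly.dvd ℚ θ h0
    rw [minpoly_eq_octicRat hirr hθ] at h1
    have h2 := eq_zero_of_dvd_of_degree_lt h1 (by
      rw [degree_map_eq_of_injective Int.cast_injective,
        degree_map_eq_of_injective Int.cast_injective,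
        degree_eq_natDegree (octic_monic a b).ne_zero, octic_natDegree]
      exact hdeg)
    exact (Polynomial.map_eq_zero_iff Int.cast_injective).1 h2
  rw [← sub_eq_zero.1 hzero, coeff_C_mul]
  exact dvd_mul_right _ _

lemma algEquiv_ext_of_adjoin_eq_top (htop : Algebra.adjoin ℚ {θ} = ⊤) {σ τ : K ≃ₐ[ℚ] K}
    (h : σ θ = τ θ) : σ = τ := by
  have : (σ : K →ₐ[ℚ] K) = τ := AlgHom.ext_of_adjoin_eq_top htop (by
    intro x hx
    rw [Set.mem_singleton_iff.1 hx]
    exact h)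
  ext x
  exact DFunLike.congr_fun this x

lemma exists_algEquiv_apply_eq [Normal ℚ K] (hirr : Irreducible (octicRat a b))
    (hθ : θ ^ 8 + a * θ ^ 4 + b = 0) {x : K} (hx : x ^ 8 + a * x ^ 4 + b = 0) :
    ∃ σ : K ≃ₐ[ℚ] K, σ θ = x := by
  have : IsConjRoot ℚ x θ := by
    rw [isConjRoot_def, minpoly_eq_octicRat hirr hθ, minpoly_eq_octicRat hirr hx]
  exact this.exists_algEquiv

lemma exists_int_eq_of_fixed [IsGalois ℚ K] {x : K} (hx : IsIntegral ℤ x)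
    (h : ∀ σ : K ≃ₐ[ℚ] K, σ x = x) : ∃ n : ℤ, x = n := by
  obtain ⟨q, rfl⟩ := (IsGalois.mem_range_algebraMap_iff_fixed x).2 h
  have hq : IsIntegral ℤ q :=
    (isIntegral_algebraMap_iff (algebraMap ℚ K).injective).1 hx
  obtain ⟨n, rfl⟩ := IsIntegrallyClosed.isIntegral_iff.1 hq
  exact ⟨n, by simp⟩

lemma ne_zero_of_irreducible (hirr : Irreducible (octicRat a b))
    (hθ : θ ^ 8 + a * θ ^ 4 + b = 0) : θ ≠ 0 := by
  rintro rfl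
  have h := congrArg natDegree (minpoly_eq_octicRat hirr hθ)
  rw [minpoly.zero, natDegree_X, natDegree_map_eq_of_injective Int.cast_injective,
    octic_natDegree] at h
  norm_num at h

/-- An automorphism maps `θ ^ 4` to itself or to the conjugate `-a - θ ^ 4`. -/
lemma map_pow_four (hθ : θ ^ 8 + a * θ ^ 4 + b = 0) (ρ : K ≃ₐ[ℚ] K) :
    (ρ θ) ^ 4 = θ ^ 4 ∨ (ρ θ) ^ 4 = -a - θ ^ 4 := by
  have h := congrArg ρ hθ
  simp only [map_add, map_mul, map_pow, map_intCast, map_zero] at h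
  have : ((ρ θ) ^ 4 - θ ^ 4) * ((ρ θ) ^ 4 - (-a - θ ^ 4)) = 0 := by
    linear_combination h - hθ
  rcases mul_eq_zero.1 this with h | h
  · exact Or.inl (sub_eq_zero.1 h)
  · exact Or.inr (sub_eq_zero.1 h)

/-- The Galois group of `x⁸ - x⁴ + 1` is commutative, `θ` being a primitive 24th root of unity. -/
lemma commute_of_root_cyclotomic (hθ : θ ^ 8 - θ ^ 4 + 1 = 0)
    (htop : Algebra.adjoin ℚ {θ} = ⊤) (x y : K ≃ₐ[ℚ] K) : x * y = y * x := by
  have h12 : θ ^ 12 = -1 := by linear_combination (θ ^ 4 + 1) * hθ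
  have h24 : θ ^ 24 = 1 := by linear_combination (θ ^ 12 - 1) * h12
  have hprim : IsPrimitiveRoot θ 24 := by
    rw [IsPrimitiveRoot.iff_orderOf]
    refine orderOf_eq_of_pow_and_pow_div_prime (by norm_num) h24 fun p hp hdvd ↦ ?_
    have hp23 : p = 2 ∨ p = 3 := by
      have : p ∣ 2 ^ 3 * 3 := hdvd
      rcases hp.dvd_mul.1 this with h | h
      · exact Or.inl ((Nat.prime_dvd_prime_iff_eq hp Nat.prime_two).1 (hp.dvd_of_dvd_pow h))
      · exact Or.inr ((Nat.prime_dvd_prime_iff_eq hp Nat.prime_three).1 h)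
    rcases hp23 with rfl | rfl
    · norm_num [h12]
    · norm_num
      intro h8
      have h4 : θ ^ 4 = 2 := by linear_combination h8 - hθ
      have : (3 : K) = 0 := by linear_combination h8 - (θ ^ 4 + 2) * h4
      norm_num at this
  have hpow : ∀ ρ : K ≃ₐ[ℚ] K, ∃ k : ℕ, ρ θ = θ ^ k := by
    intro ρ
    obtain ⟨k, -, hk⟩ := hprim.eq_pow_of_pow_eq_one (ξ := ρ θ) (by rw [← map_pow, h24, map_one])
    exact ⟨k, hk.symm⟩
  obtain ⟨k, hk⟩ := hpow x
  obtain ⟨l, hl⟩ := hpow y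
  refine algEquiv_ext_of_adjoin_eq_top htop ?_
  rw [AlgEquiv.mul_apply, AlgEquiv.mul_apply, hk, hl, map_pow, map_pow, hk, hl, ← pow_mul,
    ← pow_mul, mul_comm]

variable [IsGalois ℚ K] {i φ : K}

/-- If the automorphism `θ ↦ iθ` does not fix `i`, then `-θ⁴` is the square of an
element of the quadratic field `ℚ(θ⁴)`, whose trace and norm are the integers `n` and `e`. -/
lemma exists_trace_norm (hirr : Irreducible (octicRat a b))
    (hθ : θ ^ 8 + a * θ ^ 4 + b = 0) (htop : Algebra.adjoin ℚ {θ} = ⊤)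
    (hi : i ^ 2 = -1) (hφ : φ ^ 4 = -a - θ ^ 4) {σ : K ≃ₐ[ℚ] K} (hσ : σ θ = i * θ)
    (hσi : σ i = -i) :
    ∃ n e : ℤ, a = n ^ 2 - 2 * e ∧ b = e ^ 2 ∧ (n : K) * (i * θ ^ 2) = θ ^ 4 - e := by
  have hθ0 := ne_zero_of_irreducible hirr hθ
  obtain ⟨β, hβ⟩ : ∃ β : K, β = -(i * θ ^ 2) := ⟨_, rfl⟩
  have hβ2 : β ^ 2 = -θ ^ 4 := by rw [hβ]; linear_combination θ ^ 4 * hi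
  -- Automorphisms fixing `θ ^ 4` fix `β`.
  have hfix : ∀ ρ : K ≃ₐ[ℚ] K, (ρ θ) ^ 4 = θ ^ 4 → ρ β = β := by
    have hneg : ∀ μ : K ≃ₐ[ℚ] K, μ θ = -θ → μ i = i := by
      intro μ hμ
      refine (map_sq_eq_neg_one hi μ).resolve_right fun hμi ↦ ?_
      have h1 : μ * σ = σ := algEquiv_ext_of_adjoin_eq_top htop (by
        rw [AlgEquiv.mul_apply, hσ, map_mul, hμ, hμi]; ring)
      have h2 : μ = 1 := by simpa using h1
      rw [h2, AlgEquiv.one_apply] at hμ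
      exact hθ0 (self_eq_neg.1 hμ)
    have hiθ : ∀ ρ : K ≃ₐ[ℚ] K, ρ θ = i * θ → ρ β = β := by
      intro ρ h
      rw [algEquiv_ext_of_adjoin_eq_top htop (h.trans hσ.symm), hβ, map_neg, map_mul, map_pow,
        hσ, hσi]
      linear_combination i * θ ^ 2 * hi
    intro ρ hρ
    rcases eq_of_pow_four_eq hi hρ with h | h | h | h
    · rw [algEquiv_ext_of_adjoin_eq_top htop (τ := 1) h, AlgEquiv.one_apply]
    · rw [hβ, map_neg, map_mul, map_pow, h, hneg ρ h]; ring
    · exact hiθ ρ h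
    · obtain ⟨μ, hμ⟩ := exists_algEquiv_apply_eq hirr hθ (x := -θ) (by linear_combination hθ)
      have hμβ : μ β = β := by rw [hβ, map_neg, map_mul, map_pow, hμ, hneg μ hμ]; ring
      have h1 : μ * σ = ρ := algEquiv_ext_of_adjoin_eq_top htop (by
        rw [AlgEquiv.mul_apply, hσ, map_mul, hμ, hneg μ hμ, h]; ring)
      rw [← h1, AlgEquiv.mul_apply, hiθ σ hσ, hμβ]
  obtain ⟨τ, hτ⟩ := exists_algEquiv_apply_eq hirr hθ (x := φ) (by
    linear_combination (φ ^ 4 - θ ^ 4) * hφ + hθ)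
  have hτ4 : τ (θ ^ 4) = -a - θ ^ 4 := by rw [map_pow, hτ, hφ]
  have hτβ : (τ β) ^ 2 = a + θ ^ 4 := by rw [← map_pow, hβ2, map_neg, hτ4]; ring
  have hττ : τ (τ β) = β := by
    have := hfix (τ * τ) (by
      rw [← map_pow, AlgEquiv.mul_apply, hτ4, map_sub, hτ4, map_neg, map_intCast]; ring)
    simpa using this
  have hswap : ∀ ρ : K ≃ₐ[ℚ] K, (ρ β = β ∧ ρ (τ β) = τ β) ∨ (ρ β = τ β ∧ ρ (τ β) = β) := by
    have hsame : ∀ ρ : K ≃ₐ[ℚ] K, (ρ θ) ^ 4 = θ ^ 4 → ρ β = β ∧ ρ (τ β) = τ β := by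
      intro ρ h
      refine ⟨hfix ρ h, ?_⟩
      have := hfix (τ * (ρ * τ)) (by
        rw [← map_pow, AlgEquiv.mul_apply, AlgEquiv.mul_apply, hτ4, map_sub, map_pow ρ, h,
          map_sub, hτ4]
        simp)
      have h3 : τ (ρ (τ β)) = τ (τ β) := by rw [hττ]; simpa using this
      exact τ.injective h3
    intro ρ
    rcases map_pow_four hθ ρ with h | h
    · exact Or.inl (hsame ρ h)
    · obtain ⟨h1, h2⟩ := hsame (τ * ρ) (by
        rw [← map_pow, AlgEquiv.mul_apply, map_pow ρ, h, map_sub, hτ4]; simp)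
      simp only [AlgEquiv.mul_apply] at h1 h2
      exact Or.inr ⟨τ.injective (h1.trans hττ.symm), τ.injective h2⟩
  have hint : IsIntegral ℤ β := by
    rw [hβ]
    exact ((isIntegral_of_sq_eq_neg_one hi).mul ((isIntegral_of_root hθ).pow 2)).neg
  have hint' : IsIntegral ℤ (τ β) := hint.map (τ.toAlgHom.restrictScalars ℤ)
  obtain ⟨n, hn⟩ := exists_int_eq_of_fixed (hint.add hint') (fun ρ ↦ by
    rcases hswap ρ with ⟨h1, h2⟩ | ⟨h1, h2⟩ <;> rw [map_add, h1, h2]; rw [add_comm])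
  obtain ⟨e, he⟩ := exists_int_eq_of_fixed (hint.mul hint') (fun ρ ↦ by
    rcases hswap ρ with ⟨h1, h2⟩ | ⟨h1, h2⟩ <;> rw [map_mul, h1, h2]; rw [mul_comm])
  refine ⟨n, e, ?_, ?_, ?_⟩
  · have : (a : K) = (n : K) ^ 2 - 2 * e := by
      rw [← hn, ← he]; linear_combination -hβ2 - hτβ
    exact_mod_cast this
  · have : (b : K) = (e : K) ^ 2 := by
      rw [← he, mul_pow, hβ2, hτβ]; linear_combination hθ
    exact_mod_cast this
  · rw [← hn, ← he]
    linear_combination (β + τ β) * hβ - hβ2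

/-- If `ℤ[θ]` is the ring of integers and the automorphism `θ ↦ iθ` does not fix `i`, then
only `a = -1` and `a = 3` are possible. -/
lemma coeffs_of_map_i_eq_neg (hirr : Irreducible (octicRat a b))
    (hθ : θ ^ 8 + a * θ ^ 4 + b = 0) (htop : Algebra.adjoin ℚ {θ} = ⊤)
    (hmon : Algebra.adjoin ℤ {θ} = integralClosure ℤ K)
    (hi : i ^ 2 = -1) (hφ : φ ^ 4 = -a - θ ^ 4) {σ : K ≃ₐ[ℚ] K} (hσ : σ θ = i * θ)
    (hσi : σ i = -i) : (a = -1 ∨ a = 3) ∧ b = 1 := by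
  have hθ0 := ne_zero_of_irreducible hirr hθ
  obtain ⟨n, e, ha, hb, hn⟩ := exists_trace_norm hirr hθ htop hi hφ hσ hσi
  have hbK : (b : K) = (e : K) ^ 2 := by exact_mod_cast congrArg (Int.cast : ℤ → K) hb
  have he0 : (e : K) ≠ 0 := by
    intro h
    have h1 : θ ^ 4 * (θ ^ 4 + a) = 0 := by rw [hbK, h] at hθ; linear_combination hθ
    have h2 : φ ^ 4 = 0 := by
      rw [hφ]; linear_combination -(mul_eq_zero.1 h1).resolve_left (pow_ne_zero 4 hθ0)
    obtain ⟨τ, hτ⟩ := exists_algEquiv_apply_eq hirr hθ (x := φ) (by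
      linear_combination (φ ^ 4 - θ ^ 4) * hφ + hθ)
    rw [pow_eq_zero_iff (by norm_num), ← hτ, map_eq_zero] at h2
    exact hθ0 h2
  have he : e ∣ 1 := by
    have hα : IsIntegral ℤ ((e : K) / θ) := by
      refine ⟨octic (a * e ^ 2) (e ^ 6), octic_monic _ _, ?_⟩
      rw [← aeval_def, aeval_octic]
      field_simp
      push_cast
      linear_combination (e : K) ^ 6 * hθ - (e : K) ^ 6 * hbK
    have hmem : (e : K) / θ ∈ Algebra.adjoin ℤ {θ} := hmon ▸ hα
    have := dvd_coeff_of_mem_adjoin hirr hθ hmem (m := e) (g := -(X ^ 7 + C a * X ^ 3))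
      (by compute_degree!) (by
        simp only [map_neg, map_add, map_mul, map_pow, aeval_X, eq_intCast, map_intCast]
        field_simp
        linear_combination hθ - hbK) 7
    simpa [coeff_X] using this
  have he2 : e ^ 2 = 1 := by
    rcases Int.isUnit_iff.1 (isUnit_of_dvd_one he) with rfl | rfl <;> norm_num
  have he2K : (e : K) ^ 2 = 1 := by exact_mod_cast congrArg (Int.cast : ℤ → K) he2
  have hmem : i ∈ Algebra.adjoin ℤ {θ} := hmon ▸ isIntegral_of_sq_eq_neg_one hi
  have hne : n ∣ e := by
    have := dvd_coeff_of_mem_adjoin hirr hθ hmem (m := n)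
      (g := X ^ 2 + C e * (X ^ 6 + C a * X ^ 2)) (by compute_degree!) (by
        simp only [map_add, map_mul, map_pow, aeval_X, eq_intCast, map_intCast]
        apply mul_right_cancel₀ (pow_ne_zero 2 hθ0)
        linear_combination hn - e * hθ + e * hbK + e * he2K) 6
    simpa [coeff_X] using this
  have hn2 : n ^ 2 = 1 := by
    rcases Int.isUnit_iff.1 (isUnit_of_dvd_one (hne.trans he)) with rfl | rfl <;> norm_num
  refine ⟨?_, hb.trans he2⟩
  rcases Int.isUnit_iff.1 (isUnit_of_dvd_one he) with rfl | rfl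
  · left; linarith
  · right; linarith

/-- If `ℤ[θ]` is the ring of integers and the automorphism `θ ↦ iθ` fixes `i`, then the Galois
group is commutative. -/
lemma commute_of_map_i_eq (hirr : Irreducible (octicRat a b))
    (hθ : θ ^ 8 + a * θ ^ 4 + b = 0) (htop : Algebra.adjoin ℚ {θ} = ⊤)
    (hmon : Algebra.adjoin ℤ {θ} = integralClosure ℤ K)
    (hi : i ^ 2 = -1) (hφ : φ ^ 4 = -a - θ ^ 4) {σ : K ≃ₐ[ℚ] K} (hσ : σ θ = i * θ)
    (hσi : σ i = i) (x y : K ≃ₐ[ℚ] K) : x * y = y * x := by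
  have hθ0 := ne_zero_of_irreducible hirr hθ
  obtain ⟨τ, hτ⟩ := exists_algEquiv_apply_eq hirr hθ (x := φ) (by
    linear_combination (φ ^ 4 - θ ^ 4) * hφ + hθ)
  have hφ0 : φ ≠ 0 := by rw [← hτ]; simpa using hθ0
  have hσ2 : (σ ^ 2) θ = -θ := by
    rw [pow_two, AlgEquiv.mul_apply, hσ, map_mul, hσ, hσi]; linear_combination θ * hi
  have hσ3 : (σ ^ 3) θ = -(i * θ) := by
    rw [pow_succ', AlgEquiv.mul_apply, hσ2, map_neg, hσ]
  have hpow : ∀ ρ : K ≃ₐ[ℚ] K, (ρ θ) ^ 4 = θ ^ 4 → ∃ k : ℕ, ρ = σ ^ k := by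
    intro ρ hρ
    rcases eq_of_pow_four_eq hi hρ with h | h | h | h
    · exact ⟨0, algEquiv_ext_of_adjoin_eq_top htop h⟩
    · exact ⟨2, algEquiv_ext_of_adjoin_eq_top htop (h.trans hσ2.symm)⟩
    · exact ⟨1, algEquiv_ext_of_adjoin_eq_top htop (by rw [h, pow_one, hσ])⟩
    · exact ⟨3, algEquiv_ext_of_adjoin_eq_top htop (h.trans hσ3.symm)⟩
  have hτ4 : τ (θ ^ 4) = -a - θ ^ 4 := by rw [map_pow, hτ, hφ]
  have hgen : ∀ ρ : K ≃ₐ[ℚ] K, ∃ k : ℕ, ρ = σ ^ k ∨ τ * ρ = σ ^ k := by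
    intro ρ
    rcases map_pow_four hθ ρ with h | h
    · obtain ⟨k, hk⟩ := hpow ρ h
      exact ⟨k, Or.inl hk⟩
    · obtain ⟨k, hk⟩ := hpow (τ * ρ) (by
        rw [← map_pow, AlgEquiv.mul_apply, map_pow ρ, h, map_sub, hτ4]; simp)
      exact ⟨k, Or.inr hk⟩
  have hσφ : σ φ = φ ∨ σ φ = -φ ∨ σ φ = i * φ ∨ σ φ = -(i * φ) := by
    apply eq_of_pow_four_eq hi
    rw [← map_pow, hφ, map_sub, map_pow, hσ, map_neg, map_intCast]
    linear_combination -θ ^ 4 * (i ^ 2 - 1) * hi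
  have hσσφ : σ (σ φ) ≠ φ := by
    intro h
    have h1 : σ ^ 2 * τ = τ := algEquiv_ext_of_adjoin_eq_top htop (by
      rw [AlgEquiv.mul_apply, hτ, pow_two, AlgEquiv.mul_apply, h])
    have h2 : σ ^ 2 = 1 := by simpa using h1
    rw [h2, AlgEquiv.one_apply] at hσ2
    exact hθ0 (self_eq_neg.1 hσ2)
  have hfix : ∀ {z : K}, σ z = z → ∀ k : ℕ, (σ ^ k) z = z := by
    intro z hz k
    induction k with
    | zero => simp
    | succ k ih => rw [pow_succ, AlgEquiv.mul_apply, hz, ih]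
  -- An element fixed by `σ` and `τ` is fixed by the whole group.
  have hfixed : ∀ z : K, σ z = z → τ z = z → ∀ ρ : K ≃ₐ[ℚ] K, ρ z = z := by
    intro z h1 h2 ρ
    obtain ⟨k, rfl | hk⟩ := hgen ρ
    · exact hfix h1 k
    · have : τ (ρ z) = τ z := by
        rw [h2, ← AlgEquiv.mul_apply, hk, hfix h1 k]
      exact τ.injective this
  have hτi : τ i = -i := by
    refine (map_sq_eq_neg_one hi τ).resolve_left fun h ↦ ?_
    obtain ⟨n, hn⟩ := exists_int_eq_of_fixed (isIntegral_of_sq_eq_neg_one hi) (hfixed i hσi h)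
    have : n ^ 2 = -1 := by rw [hn] at hi; exact_mod_cast hi
    nlinarith [sq_nonneg n]
  rcases hσφ with h | h | h | h
  · exact absurd (by rw [h, h]) hσσφ
  · exact absurd (by rw [h, map_neg, h, neg_neg]) hσσφ
  · exfalso
    have hδint : IsIntegral ℤ (i * (2 * θ ^ 4 + a)) := by
      have h2 : IsIntegral ℤ (2 : K) := 
        by simpa using isIntegral_algebraMap (R := ℤ) (A := K) (x := 2)
      have ha : IsIntegral ℤ (a : K) := isIntegral_algebraMap (R := ℤ) (x := a)
      exact (isIntegral_of_sq_eq_neg_one hi).mul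
        ((h2.mul ((isIntegral_of_root hθ).pow 4)).add ha)
    obtain ⟨m, hm⟩ := exists_int_eq_of_fixed hδint (hfixed _ (by
        simp only [map_mul, map_add, map_pow, map_intCast, map_ofNat, hσ, hσi]
        linear_combination 2 * i * θ ^ 4 * (i ^ 2 - 1) * hi) (by
        rw [map_mul, map_add, map_mul, hτ4, hτi, map_intCast, map_ofNat]
        ring))
    have hm2 : a ^ 2 + m ^ 2 = 4 * b := by
      have : (a : K) ^ 2 + (m : K) ^ 2 = 4 * b := by
        rw [← hm]; linear_combination (2 * θ ^ 4 + a) ^ 2 * hi - 4 * hθ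
      exact_mod_cast this
    obtain ⟨s, hs⟩ : Even a := by
      by_contra hodd
      rw [Int.not_even_iff_odd] at hodd
      obtain ⟨k, hk⟩ := hodd
      rcases Int.even_or_odd m with ⟨l, hl⟩ | ⟨l, hl⟩
      · have : 4 * (k ^ 2 + k + l ^ 2 - b) = -1 := by rw [hk, hl] at hm2; linarith
        omega
      · have : 4 * (k ^ 2 + k + l ^ 2 + l - b) = -2 := by rw [hk, hl] at hm2; linarith
        omega
    obtain ⟨t, ht⟩ : Even m := by
      have : Even (m ^ 2) := ⟨2 * b - 2 * s ^ 2, by rw [hs] at hm2; linarith⟩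
      exact (Int.even_pow.1 this).1
    have haK : (a : K) = s + s := by exact_mod_cast congrArg (Int.cast : ℤ → K) hs
    have hmK : (m : K) = t + t := by exact_mod_cast congrArg (Int.cast : ℤ → K) ht
    have hit : (t : K) * i = -θ ^ 4 - s := by
      apply mul_left_cancel₀ (two_ne_zero' K)
      linear_combination -i * hmK - i * hm + (2 * θ ^ 4 + a) * hi - haK
    have hmem : i ∈ Algebra.adjoin ℤ {θ} := hmon ▸ isIntegral_of_sq_eq_neg_one hi
    have ht1 : t ∣ 1 := by
      have := dvd_coeff_of_mem_adjoin hirr hθ hmem (m := t)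
        (g := -X ^ 4 - C s) (by compute_degree!) (by simpa using hit) 4
      simpa [coeff_X, coeff_C, -eq_intCast] using this
    have ht2 : t ^ 2 = 1 := by
      rcases Int.isUnit_iff.1 (isUnit_of_dvd_one ht1) with rfl | rfl <;> norm_num
    have hb : b = s ^ 2 + 1 := by rw [hs, ht] at hm2; linarith
    -- `θ²φ²` is a square root of `b` fixed up to sign by the whole group.
    have hc : (θ ^ 2 * φ ^ 2) ^ 2 = b := by
      rw [mul_pow, ← pow_mul, ← pow_mul, hφ]; linear_combination -hθ
    have hσc : σ (θ ^ 2 * φ ^ 2) = θ ^ 2 * φ ^ 2 := by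
      rw [map_mul, map_pow, map_pow, hσ, h]
      linear_combination θ ^ 2 * φ ^ 2 * (i ^ 2 - 1) * hi
    have hcint : IsIntegral ℤ (θ ^ 2 * φ ^ 2) :=
      IsIntegral.of_pow two_pos (hc ▸ isIntegral_algebraMap (R := ℤ) (x := b))
    have hτc : τ (θ ^ 2 * φ ^ 2) = θ ^ 2 * φ ^ 2 ∨ τ (θ ^ 2 * φ ^ 2) = -(θ ^ 2 * φ ^ 2) := by
      apply sq_eq_sq_iff_eq_or_eq_neg.1
      rw [← map_pow, hc, map_intCast]
    have hs0 : s = 0 := by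
      rcases hτc with h1 | h1
      · obtain ⟨c, hcc⟩ := exists_int_eq_of_fixed hcint (hfixed _ hσc h1)
        have hc2 : c ^ 2 = s ^ 2 + 1 := by
          rw [hcc, hb] at hc; exact_mod_cast hc
        by_contra hs0
        have h3 : 0 < |s| := abs_pos.2 hs0
        have h4 : |s| < |c| := sq_lt_sq.1 (by linarith)
        rw [← sq_abs c, ← sq_abs s] at hc2
        nlinarith
      · obtain ⟨c, hcc⟩ := exists_int_eq_of_fixed
          ((isIntegral_of_sq_eq_neg_one hi).mul hcint)
          (hfixed _ (by rw [map_mul, hσc, hσi]) (by rw [map_mul, hτi, h1]; ring))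
        have hc2 : c ^ 2 = -(s ^ 2 + 1) := by
          have : (c : K) ^ 2 = -b := by
            rw [← hcc, mul_pow, hc, hi]; ring
          rw [hb] at this
          exact_mod_cast this
        nlinarith [sq_nonneg c, sq_nonneg s]
    have hb1 : (b : K) = 1 := by rw [hb, hs0]; norm_num
    have hσθφ : σ (θ * φ) = -(θ * φ) := by
      rw [map_mul, hσ, h]; linear_combination θ * φ * hi
    have hfixθφ : σ (θ * φ) = θ * φ := by
      rcases eq_of_pow_four_eq hi (x := θ * φ) (y := 1) (by
        linear_combination hc + hb1) with h | h | h | h <;> rw [h] <;> simp [hσi]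
    exact mul_ne_zero hθ0 hφ0 (self_eq_neg.1 (hfixθφ.symm.trans hσθφ))
  · have hcomm : Commute σ τ := algEquiv_ext_of_adjoin_eq_top htop (by
      rw [AlgEquiv.mul_apply, AlgEquiv.mul_apply, hτ, hσ, h, map_mul, hτi, hτ]; ring)
    have hform : ∀ ρ : K ≃ₐ[ℚ] K, ∃ k : ℕ, ρ = σ ^ k ∨ ρ = τ⁻¹ * σ ^ k := by
      intro ρ
      obtain ⟨k, hk | hk⟩ := hgen ρ
      · exact ⟨k, Or.inl hk⟩
      · exact ⟨k, Or.inr (eq_inv_mul_of_mul_eq hk)⟩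
    have hpp : ∀ k l : ℕ, Commute (σ ^ k) (σ ^ l) := fun k l ↦ Commute.pow_pow_self σ k l
    have hpt : ∀ k : ℕ, Commute (σ ^ k) τ⁻¹ := fun k ↦ (hcomm.pow_left k).inv_right
    obtain ⟨k, rfl | rfl⟩ := hform x <;> obtain ⟨l, rfl | rfl⟩ := hform y
    · exact hpp k l
    · exact (hpt k).mul_right (hpp k l)
    · exact ((hpt l).symm).mul_left (hpp k l)
    · exact ((Commute.refl _).mul_left (hpt k)).mul_right (((hpt l).symm).mul_left (hpp k l))

/-- If `x⁸ + a x⁴ + b` splits in a number field of degree `8` with noncommutative Galois group, and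
the integers of this field are `ℤ[θ]` for each root `θ`, then `a = 3` and `b = 1`. -/
lemma coeffs_of_splits (hirr : Irreducible (octicRat a b))
    (hsplit : ((octicRat a b).map (algebraMap ℚ K)).Splits) (hfin : Module.finrank ℚ K = 8)
    (hmono : ∀ θ : K, aeval θ (octic a b) = 0 → Algebra.adjoin ℚ {θ} = ⊤ →
      Algebra.adjoin ℤ {θ} = integralClosure ℤ K)
    (hnc : ¬ ∀ x y : K ≃ₐ[ℚ] K, x * y = y * x) : a = 3 ∧ b = 1 := by
  have hnd : (octicRat a b).natDegree = 8 := by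
    rw [natDegree_map_eq_of_injective Int.cast_injective, octic_natDegree]
  have hmap : (octicRat a b).map (algebraMap ℚ K) = X ^ 8 + C (a : K) * X ^ 4 + C (b : K) := by
    simp [octicRat, octic]
  have hne : (octicRat a b).map (algebraMap ℚ K) ≠ 0 :=
    (Polynomial.map_ne_zero_iff (algebraMap ℚ K).injective).2 hirr.ne_zero
  obtain ⟨θ, hθ⟩ := hsplit.exists_eval_eq_zero (by
    rw [degree_map]; exact (degree_pos_of_irreducible hirr).ne')
  have hθ : θ ^ 8 + a * θ ^ 4 + b = 0 := by simpa [hmap] using hθ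
  have hθ0 := ne_zero_of_irreducible hirr hθ
  obtain ⟨j, hj⟩ : ∃ j : K, j ^ 2 = -θ ^ 2 := by
    have hdvd : (X ^ 2 + C (θ ^ 2) : K[X]) ∣ (octicRat a b).map (algebraMap ℚ K) := by
      refine ⟨(X ^ 2 - C (θ ^ 2)) * (X ^ 4 + C (θ ^ 4 + a)), ?_⟩
      rw [hmap, show (b : K) = -θ ^ 8 - a * θ ^ 4 by linear_combination hθ]
      simp only [map_add, map_sub, map_mul, map_pow, map_neg]
      ring
    obtain ⟨j, hj⟩ := (hsplit.of_dvd hne hdvd).exists_eval_eq_zero (by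
      rw [degree_X_pow_add_C two_pos]; norm_num)
    exact ⟨j, by simpa [add_eq_zero_iff_eq_neg] using hj⟩
  have hi : (j / θ) ^ 2 = -1 := by rw [div_pow, hj, neg_div, div_self (pow_ne_zero 2 hθ0)]
  obtain ⟨φ, hφ⟩ : ∃ φ : K, φ ^ 4 = -a - θ ^ 4 := by
    have hdvd : (X ^ 4 + C (θ ^ 4 + a) : K[X]) ∣ (octicRat a b).map (algebraMap ℚ K) := by
      refine ⟨X ^ 4 - C (θ ^ 4), ?_⟩
      rw [hmap, show (b : K) = -θ ^ 8 - a * θ ^ 4 by linear_combination hθ]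
      simp only [map_add, map_sub, map_mul, map_pow, map_neg]
      ring
    obtain ⟨φ, hφ⟩ := (hsplit.of_dvd hne hdvd).exists_eval_eq_zero (by
      rw [degree_X_pow_add_C four_pos]; norm_num)
    refine ⟨φ, ?_⟩
    simp at hφ
    linear_combination hφ
  have htop : Algebra.adjoin ℚ {θ} = ⊤ := by
    rw [← IntermediateField.adjoin_simple_toSubalgebra_of_isAlgebraic
      (Algebra.IsAlgebraic.isAlgebraic θ), Field.primitive_element_iff_minpoly_natDegree_eq ℚ θ |>.2
      (by rw [minpoly_eq_octicRat hirr hθ, hnd, hfin]), IntermediateField.top_toSubalgebra]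
  have hmon := hmono θ (by rw [aeval_octic, hθ]) htop
  obtain ⟨σ, hσ⟩ := exists_algEquiv_apply_eq hirr hθ (x := j / θ * θ) (by
    linear_combination hθ + θ ^ 4 * ((j / θ) ^ 2 - 1) *
      (θ ^ 4 * ((j / θ) ^ 4 + 1) + a) * hi)
  rcases map_sq_eq_neg_one hi σ with h | h
  · exact absurd (commute_of_map_i_eq hirr hθ htop hmon hi hφ hσ h) hnc
  · obtain ⟨rfl | rfl, rfl⟩ := coeffs_of_map_i_eq_neg hirr hθ htop hmon hi hφ hσ h
    · refine absurd (commute_of_root_cyclotomic (θ := θ) ?_ htop) hnc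
      push_cast at hθ
      linear_combination hθ
    · exact ⟨rfl, rfl⟩

end Octic

/-- A monogenic `x⁸ + a x⁴ + b` with dihedral Galois group of order 8 has `a = 3` and `b = 1`. -/
lemma coeffs_of_isMonogenic_of_gal {a b : ℤ} (hmono : IsMonogenic (octic a b))
    (e : (octicRat a b).Gal ≃* DihedralGroup 4) : a = 3 ∧ b = 1 := by
  obtain ⟨-, hirr, hmono⟩ := hmono
  change Irreducible (octicRat a b) at hirr
  have hsep : (octicRat a b).Separable := hirr.separable
  have : IsSplittingField ℚ (octicRat a b).SplittingField (octicRat a b) :=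
    IsSplittingField.splittingField _
  have : IsGalois ℚ (octicRat a b).SplittingField :=
    IsGalois.of_separable_splitting_field (p := octicRat a b) hsep
  have : NumberField (octicRat a b).SplittingField := { }
  refine coeffs_of_splits hirr (SplittingField.splits _) ?_ (hmono _) ?_
  · rw [← Gal.card_of_separable hsep, Nat.card_congr e.toEquiv, DihedralGroup.nat_card]
  · intro h
    have := h (e.symm (DihedralGroup.r 1)) (e.symm (DihedralGroup.sr 0))
    have h1 : e.symm (DihedralGroup.r 1 * DihedralGroup.sr 0) =
      e.symm (DihedralGroup.sr 0 * DihedralGroup.r 1) := by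
      rw [map_mul, map_mul]; exact this
    exact absurd (e.symm.injective h1) (by decide)

lemma octicRat_three_one_irreducible : Irreducible (octicRat 3 1) := by
  have hmonic := octic_monic 3 1
  have hq : (X ^ 2 + X + 1 : ℤ[X]).Monic := by monicity!
  have hqm : (X ^ 2 + X + 1 : ℤ[X]).map (algebraMap ℤ (ZMod 2)) = X ^ 2 + X + 1 := by simp
  refine (hmonic.irreducible_iff_irreducible_map_fraction_map (K := ℚ)).1 ?_
  refine generalizedEisenstein (K := ZMod 2) (q := X ^ 2 + X + 1) (p := 4) ?_ hq
    hmonic.isPrimitive (by rw [octic_natDegree]; norm_num) (by simp [hmonic.leadingCoeff]) ?_ ?_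
  · have hdeg : (X ^ 2 + X + 1 : (ZMod 2)[X]).natDegree = 2 := by compute_degree!
    have hm : (X ^ 2 + X + 1 : (ZMod 2)[X]).Monic := by monicity!
    rw [hqm, hm.irreducible_iff_roots_eq_zero_of_degree_le_three (by rw [hdeg])
      (by rw [hdeg]; norm_num)]
    refine Multiset.eq_zero_of_forall_notMem fun x hx ↦ ?_
    have h := (mem_roots'.1 hx).2
    simp only [IsRoot.def, eval_add, eval_pow, eval_X, eval_one] at h
    have key : ∀ y : ZMod 2, y ^ 2 + y + 1 ≠ 0 := by decide
    exact key x h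
  · have h2 : (2 : (ZMod 2)[X]) = 0 := CharTwo.two_eq_zero
    rw [hmonic.leadingCoeff, hqm]
    simp only [octic, Polynomial.map_add, Polynomial.map_mul, Polynomial.map_pow, map_X,
      Polynomial.map_one, Polynomial.map_ofNat, map_one, one_mul, map_ofNat]
    linear_combination
      -(2 * X ^ 7 + 5 * X ^ 6 + 8 * X ^ 5 + 8 * X ^ 4 + 8 * X ^ 3 + 5 * X ^ 2 + 2 * X) * h2
  · have hmod : octic 3 1 %ₘ (X ^ 2 + X + 1) = C 2 * X := by
      refine (div_modByMonic_unique (X ^ 6 - X ^ 5 + X ^ 3 + 2 * X ^ 2 - 3 * X + 1) _ hq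
        ⟨?_, ?_⟩).2
      · simp only [octic, map_ofNat, map_one]; ring
      · have h1 : (X ^ 2 + X + 1 : ℤ[X]).degree = 2 := by compute_degree!
        rw [h1, degree_C_mul_X (by norm_num)]
        norm_num
    intro h
    have h1 := congrArg (coeff · 1) h
    have hker : RingHom.ker (algebraMap ℤ (ZMod 2)) = Ideal.span {(2 : ℤ)} :=
      ZMod.ker_intCastRingHom 2
    rw [hmod, hker, Ideal.span_singleton_pow] at h1
    simp only [coeff_map, coeff_C_mul, coeff_X_one, mul_one, coeff_zero] at h1
    rw [Ideal.Quotient.eq_zero_iff_mem, Ideal.mem_span_singleton] at h1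
    norm_num at h1

/-- `s` cancels in `A` if every algebraic integer `z` with `s * z ∈ A` lies in `A`. -/
def Cancels {K : Type*} [Field K] (A : Subalgebra ℤ K) (s : K) : Prop :=
  ∀ z, IsIntegral ℤ z → s * z ∈ A → z ∈ A

namespace Cancels

variable {K : Type*} [Field K] {A : Subalgebra ℤ K} {s t : K}

lemma mul (hA : A ≤ integralClosure ℤ K) (ht : t ∈ A) (hs : Cancels A s) (ht' : Cancels A t) :
    Cancels A (s * t) := fun z hz h ↦
  ht' z hz (hs _ ((hA ht).mul hz) (by rwa [← mul_assoc]))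

lemma of_mul (ht : t ∈ A) (h : Cancels A (s * t)) : Cancels A s := fun z hz hsz ↦
  h z hz (by rw [mul_comm s, mul_assoc]; exact mul_mem ht hsz)

/-- An integral inverse of an element of `A` lies in `A`. -/
lemma _root_.Subalgebra.mem_of_mul_eq_one {x : K} (hs : s ∈ A) (hx : IsIntegral ℤ x)
    (h : s * x = 1) : x ∈ A := by
  obtain ⟨p, hp, hp0⟩ := hx
  have hx0 : x ≠ 0 := right_ne_zero_of_mul_eq_one h
  have hinv : Invertible x := invertibleOfNonzero hx0
  have hsx : ⅟x = s := by rw [invOf_eq_inv]; exact (eq_inv_of_mul_eq_one_left h).symm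
  have h0 : aeval s p.reverse = 0 := by
    rw [← hsx, aeval_def]
    exact (eval₂_reverse_eq_zero_iff (algebraMap ℤ K) x p).2 hp0
  rw [← X_mul_divX_add p.reverse, coeff_zero_reverse, hp.leadingCoeff] at h0
  simp only [map_add, map_mul, aeval_X, map_one] at h0
  have : x = -aeval s p.reverse.divX := by
    linear_combination x * h0 - aeval s p.reverse.divX * h
  rw [this]
  exact neg_mem (Algebra.adjoin_le (Set.singleton_subset_iff.2 hs)
    (aeval_mem_adjoin_singleton ℤ s))

/-- An element generating a maximal ideal (or the unit ideal) of `A` cancels in `A`. -/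
lemma of_residue (hA : A ≤ integralClosure ℤ K) (hs : s ∈ A) (hs0 : s ≠ 0)
    (h : ∀ y ∈ A, (∃ w ∈ A, y = s * w) ∨ ∃ y' ∈ A, ∃ w ∈ A, y * y' = 1 + s * w) :
    Cancels A s := by
  intro z hz hsz
  rcases h _ hsz with ⟨w, hw, h⟩ | ⟨y', hy', w, hw, h⟩
  · rwa [mul_left_cancel₀ hs0 h]
  · have h1 : s * (z * y' - w) = 1 := by linear_combination h
    have hint : IsIntegral ℤ (z * y' - w) := (hz.mul (hA hy')).sub (hA hw)
    have hmem := Subalgebra.mem_of_mul_eq_one hs hint h1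
    have : z = s * z * (z * y' - w) := by linear_combination -z * h1
    rw [this]
    exact mul_mem hsz hmem

end Cancels

section Adjoin

variable {K : Type*} [Field K] [CharZero K] {θ : K}

/-- If `θ` is congruent to an integer `c` modulo `s` and `s` divides a prime number `p`, then
`s` cancels in `ℤ[θ]`. -/
lemma Cancels.of_congr_int (hθ : IsIntegral ℤ θ) {s : K} (hs : s ∈ Algebra.adjoin ℤ {θ})
    {p : ℕ} (hp : p.Prime) {v : K} (hv : v ∈ Algebra.adjoin ℤ {θ})
    (hpv : (p : K) = s * v) {c : ℤ} {w : K} (hw : w ∈ Algebra.adjoin ℤ {θ})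
    (hc : θ - c = s * w) : Cancels (Algebra.adjoin ℤ {θ}) s := by
  have hA : Algebra.adjoin ℤ {θ} ≤ integralClosure ℤ K := adjoin_le_integralClosure hθ
  have hs0 : s ≠ 0 := left_ne_zero_of_mul (hpv ▸ Nat.cast_ne_zero.2 hp.ne_zero)
  refine of_residue hA hs hs0 fun y hy ↦ ?_
  have hy' : ∃ n : ℤ, ∃ w ∈ Algebra.adjoin ℤ {θ}, y = n + s * w := by
    induction hy using Algebra.adjoin_induction with
    | mem x hx =>
      rw [Set.mem_singleton_iff] at hx
      exact ⟨c, w, hw, by rw [hx]; linear_combination hc⟩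
    | algebraMap n => exact ⟨n, 0, zero_mem _, by simp⟩
    | add x y _ _ hx hy =>
      obtain ⟨m, u, hu, rfl⟩ := hx
      obtain ⟨n, v, hv, rfl⟩ := hy
      exact ⟨m + n, u + v, add_mem hu hv, by push_cast; ring⟩
    | mul x y _ _ hx hy =>
      obtain ⟨m, u, hu, rfl⟩ := hx
      obtain ⟨n, v, hv, rfl⟩ := hy
      exact ⟨m * n, m * v + n * u + s * (u * v), add_mem (add_mem (mul_mem (intCast_mem _ _) hv)
        (mul_mem (intCast_mem _ _) hu)) (mul_mem hs (mul_mem hu hv)), by push_cast; ring⟩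
  obtain ⟨n, u, hu, rfl⟩ := hy'
  by_cases hdvd : (p : ℤ) ∣ n
  · obtain ⟨m, rfl⟩ := hdvd
    refine Or.inl ⟨v * m + u, add_mem (mul_mem hv (intCast_mem _ _)) hu, ?_⟩
    push_cast
    linear_combination (m : K) * hpv
  · obtain ⟨k, l, hkl⟩ := (Nat.prime_iff_prime_int.1 hp).coprime_iff_not_dvd.2 hdvd
    refine Or.inr ⟨l, intCast_mem _ _, u * l - v * k, sub_mem (mul_mem hu (intCast_mem _ _))
      (mul_mem hv (intCast_mem _ _)), ?_⟩
    have hkl' : (k : K) * p + l * n = 1 := by exact_mod_cast congrArg (Int.cast : ℤ → K) hkl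
    linear_combination hkl' - (k : K) * hpv

/-- If `θ² + θ + 1` divides `2` in `ℤ[θ]`, then it cancels in `ℤ[θ]`. -/
lemma Cancels.sq_add_self_add_one (hθ : IsIntegral ℤ θ) {v : K} (hv : v ∈ Algebra.adjoin ℤ {θ})
    (h2 : 2 = (θ ^ 2 + θ + 1) * v) :
    Cancels (Algebra.adjoin ℤ {θ}) (θ ^ 2 + θ + 1) := by
  have hA : Algebra.adjoin ℤ {θ} ≤ integralClosure ℤ K := adjoin_le_integralClosure hθ
  have hmem : θ ∈ Algebra.adjoin ℤ {θ} := Algebra.self_mem_adjoin_singleton ℤ θ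
  have hs : θ ^ 2 + θ + 1 ∈ Algebra.adjoin ℤ {θ} :=
    add_mem (add_mem (pow_mem hmem 2) hmem) (one_mem _)
  have hs0 : θ ^ 2 + θ + 1 ≠ 0 := left_ne_zero_of_mul (h2 ▸ two_ne_zero)
  refine of_residue hA hs hs0 fun y hy ↦ ?_
  have hy' : ∃ m n : ℤ, ∃ w ∈ Algebra.adjoin ℤ {θ}, y = m + n * θ + (θ ^ 2 + θ + 1) * w := by
    induction hy using Algebra.adjoin_induction with
    | mem x hx =>
      rw [Set.mem_singleton_iff] at hx
      exact ⟨0, 1, 0, zero_mem _, by rw [hx]; simp⟩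
    | algebraMap n => exact ⟨n, 0, 0, zero_mem _, by simp⟩
    | add x y _ _ hx hy =>
      obtain ⟨m, n, u, hu, rfl⟩ := hx
      obtain ⟨m', n', v, hv, rfl⟩ := hy
      exact ⟨m + m', n + n', u + v, add_mem hu hv, by push_cast; ring⟩
    | mul x y _ _ hx hy =>
      obtain ⟨m, n, u, hu, rfl⟩ := hx
      obtain ⟨m', n', v, hv, rfl⟩ := hy
      have hlin : ∀ m n : ℤ, (m + n * θ : K) ∈ Algebra.adjoin ℤ {θ} := fun m n ↦
        add_mem (intCast_mem _ _) (mul_mem (intCast_mem _ _) hmem)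
      refine ⟨m * m' - n * n', m * n' + n * m' - n * n', n * n' + (m + n * θ) * v +
        (m' + n' * θ) * u + (θ ^ 2 + θ + 1) * (u * v), ?_, by push_cast; ring⟩
      exact add_mem (add_mem (add_mem (mul_mem (intCast_mem _ _) (intCast_mem _ _))
        (mul_mem (hlin _ _) hv)) (mul_mem (hlin _ _) hu)) (mul_mem hs (mul_mem hu hv))
  obtain ⟨m, n, u, hu, rfl⟩ := hy'
  have hvl : ∀ m n : ℤ, v * (m + n * θ) + u ∈ Algebra.adjoin ℤ {θ} := fun m n ↦
    add_mem (mul_mem hv (add_mem (intCast_mem _ _) (mul_mem (intCast_mem _ _) hmem))) hu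
  rcases Int.even_or_odd' m with ⟨k, rfl | rfl⟩ <;> rcases Int.even_or_odd' n with ⟨l, rfl | rfl⟩
  · refine Or.inl ⟨_, hvl k l, ?_⟩
    push_cast
    linear_combination (k + l * θ : K) * h2
  · refine Or.inr ⟨θ ^ 2, pow_mem hmem 2, _, add_mem (mul_mem (hvl k l) (pow_mem hmem 2))
      (sub_mem hmem (one_mem _)), ?_⟩
    push_cast
    linear_combination (k + l * θ : K) * θ ^ 2 * h2
  · refine Or.inr ⟨1, one_mem _, _, hvl k l, ?_⟩
    push_cast
    linear_combination (k + l * θ : K) * h2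
  · refine Or.inr ⟨-θ, neg_mem hmem, _, sub_mem (mul_mem (hvl k l) (neg_mem hmem))
      (one_mem _), ?_⟩
    push_cast
    linear_combination -(k + l * θ : K) * θ * h2

end Adjoin

/-- The derivative of the minimal polynomial at a generator `θ` multiplies the ring of integers
into `ℤ[θ]`. -/
lemma aeval_derivative_mul_mem_adjoin {K : Type*} [Field K] [NumberField K] {θ : K}
    (hθ : IsIntegral ℤ θ) (htop : Algebra.adjoin ℚ {θ} = ⊤) {z : K} (hz : IsIntegral ℤ z) :
    aeval θ (derivative (minpoly ℚ θ)) * z ∈ Algebra.adjoin ℤ {θ} := by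
  have hne : aeval θ (derivative (minpoly ℚ θ)) ≠ 0 :=
    (Algebra.IsSeparable.isSeparable ℚ θ).aeval_derivative_ne_zero (minpoly.aeval ℚ θ)
  have hmem : z ∈ (Algebra.traceForm ℚ K).dualSubmodule
      (Subalgebra.toSubmodule (Algebra.adjoin ℤ {θ})) := by
    rw [LinearMap.BilinForm.mem_dualSubmodule]
    intro y hy
    have hy' : IsIntegral ℤ y := adjoin_le_integralClosure hθ hy
    have := Algebra.isIntegral_trace (L := ℚ) (hz.mul hy')
    obtain ⟨n, hn⟩ := IsIntegrallyClosed.isIntegral_iff.1 this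
    rw [Algebra.traceForm_apply, ← hn]
    exact Submodule.algebraMap_mem n
  rw [traceForm_dualSubmodule_adjoin ℤ ℚ htop hθ] at hmem
  obtain ⟨y, hy, rfl⟩ := hmem
  simpa [hne] using hy

/-- The element `i = -(θ⁶ + 2θ²)` is a square root of `-1` for each root `θ` of `x⁸ + 3x⁴ + 1`. -/
lemma sq_eq_neg_one_of_root {K : Type*} [Field K] {θ : K} (hθ : θ ^ 8 + 3 * θ ^ 4 + 1 = 0) :
    (-(θ ^ 6 + 2 * θ ^ 2)) ^ 2 = -1 := by
  linear_combination (θ ^ 4 + 1) * hθ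

lemma isMonogenic_octic_three_one : IsMonogenic (octic 3 1) := by
  refine ⟨octic_monic 3 1, octicRat_three_one_irreducible, fun K _ _ θ h htop ↦ ?_⟩
  rw [aeval_octic] at h
  have hint := isIntegral_of_root h
  have hmin := minpoly_eq_octicRat octicRat_three_one_irreducible h
  have hθ : θ ^ 8 + 3 * θ ^ 4 + 1 = 0 := by simpa using h
  have hA : Algebra.adjoin ℤ {θ} ≤ integralClosure ℤ K := adjoin_le_integralClosure hint
  have hmem : θ ∈ Algebra.adjoin ℤ {θ} := Algebra.self_mem_adjoin_singleton ℤ θ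
  have haeval : ∀ p : ℤ[X], aeval θ p ∈ Algebra.adjoin ℤ {θ} :=
    fun p ↦ aeval_mem_adjoin_singleton ℤ θ
  have h2 : Cancels (Algebra.adjoin ℤ {θ}) 2 := by
    have hq := haeval (X ^ 2 + X + 1)
    have hv := haeval ((X ^ 6 - X ^ 5 + X ^ 3 + 2 * X ^ 2 - 3 * X + 1) * (X ^ 7 + 3 * X ^ 3))
    have hw := haeval (2 * X ^ 7 + 5 * X ^ 6 + 8 * X ^ 5 + 8 * X ^ 4 + 8 * X ^ 3 + 5 * X ^ 2 + 2 * X)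
    simp only [map_add, map_sub, map_mul, map_pow, aeval_X, map_ofNat, map_one] at hq hv hw
    have hc := Cancels.sq_add_self_add_one hint hv (by
      linear_combination (2 - (θ ^ 7 + 3 * θ ^ 3)) * hθ)
    have hsq := Cancels.mul hA hq hc hc
    refine Cancels.of_mul hw ?_
    convert Cancels.mul hA (mul_mem hq hq) hsq hsq using 1
    linear_combination -hθ
  have hlin : ∀ u ∈ Algebra.adjoin ℤ {θ}, u ^ 4 = 1 → ∀ c : ℤ, ∀ w ∈ Algebra.adjoin ℤ {θ},
      u - c = (θ - u) * w → Cancels (Algebra.adjoin ℤ {θ}) (θ - u) := by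
    intro u hu hu4 c w hw hcw
    refine Cancels.of_congr_int hint (sub_mem hmem hu) Nat.prime_five
      (v := -((θ + u) * (θ ^ 2 + u ^ 2) * (θ ^ 4 + u ^ 4 + (3 : ℤ)))) ?_ ?_ (c := c) (w := 1 + w)
      (add_mem (one_mem _) hw) (by linear_combination hcw)
    · exact neg_mem (mul_mem (mul_mem (add_mem hmem hu) (add_mem (pow_mem hmem 2) (pow_mem hu 2)))
        (add_mem (add_mem (pow_mem hmem 4) (pow_mem hu 4)) (intCast_mem _ _)))
    · push_cast
      linear_combination hθ - (u ^ 4 + 4) * hu4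
  obtain ⟨i, hidef⟩ : ∃ i : K, i = -(θ ^ 6 + 2 * θ ^ 2) := ⟨_, rfl⟩
  have hi : i ^ 2 = -1 := hidef ▸ sq_eq_neg_one_of_root hθ
  have himem : i ∈ Algebra.adjoin ℤ {θ} := by
    have := haeval (-(X ^ 6 + 2 * X ^ 2))
    simpa only [map_neg, map_add, map_mul, map_pow, aeval_X, map_ofNat, ← hidef] using this
  have hsum : ∀ u ∈ Algebra.adjoin ℤ {θ},
      -(θ + u) * (θ ^ 4 + θ ^ 2 * u ^ 2 + u ^ 4 + (2 : ℤ)) ∈ Algebra.adjoin ℤ {θ} := fun u hu ↦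
    mul_mem (neg_mem (add_mem hmem hu)) (add_mem (add_mem (add_mem (pow_mem hmem 4)
      (mul_mem (pow_mem hmem 2) (pow_mem hu 2))) (pow_mem hu 4)) (intCast_mem _ _))
  have hone := hlin 1 (one_mem _) (one_pow 4) 1 0 (zero_mem _) (by simp)
  have hneg := hlin (-1) (neg_mem (one_mem _)) (by norm_num) (-1) 0 (zero_mem _) (by simp)
  have hpi := hlin i himem (by linear_combination (i ^ 2 - 1) * hi) 3 _ (hsum i himem) (by
    push_cast
    linear_combination hidef - (i ^ 4 - i ^ 2 + 3) * hi)
  have hni := hlin (-i) (neg_mem himem) (by linear_combination (i ^ 2 - 1) * hi) (-3) _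
    (neg_mem (hsum (-i) (neg_mem himem))) (by
      push_cast
      linear_combination -hidef + (i ^ 4 - i ^ 2 + 3) * hi)
  have h5 : Cancels (Algebra.adjoin ℤ {θ}) 5 := by
    have hreal := Cancels.mul hA (sub_mem hmem (neg_mem (one_mem _))) hone hneg
    have himag := Cancels.mul hA (sub_mem hmem (neg_mem himem)) hpi hni
    have hprod := Cancels.mul hA
      (mul_mem (sub_mem hmem himem) (sub_mem hmem (neg_mem himem))) hreal himag
    have hprod_mem := mul_mem
      (mul_mem (sub_mem hmem (one_mem _)) (sub_mem hmem (neg_mem (one_mem _))))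
      (mul_mem (sub_mem hmem himem) (sub_mem hmem (neg_mem himem)))
    refine Cancels.of_mul (t := -θ ^ 4) (neg_mem (pow_mem hmem 4)) ?_
    convert Cancels.mul hA hprod_mem hprod hprod using 1
    have hfac : (θ - 1) * (θ - -1) * ((θ - i) * (θ - -i)) = θ ^ 4 - 1 := by
      linear_combination -(θ ^ 2 - 1) * hi
    rw [hfac]
    linear_combination -hθ
  have hder : aeval θ (derivative (minpoly ℚ θ)) = 8 * θ ^ 7 + 12 * θ ^ 3 := by
    rw [hmin]
    simp [octicRat, octic, map_ofNat (aeval θ)]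
    ring
  have hcancel : Cancels (Algebra.adjoin ℤ {θ}) (aeval θ (derivative (minpoly ℚ θ))) := by
    have ht := haeval (-(X ^ 7 + 3 * X ^ 3) ^ 3 * (2 * X ^ 4 + 3))
    simp only [map_add, map_neg, map_mul, map_pow, aeval_X, map_ofNat] at ht
    refine Cancels.of_mul ht ?_
    have h5mem : (5 : K) ∈ Algebra.adjoin ℤ {θ} := by simp
    have h2mem : (2 : K) ∈ Algebra.adjoin ℤ {θ} := by simp
    convert Cancels.mul hA h5mem (Cancels.mul hA h2mem h2 h2) h5 using 1
    rw [hder]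
    have hinv : θ * (-(θ ^ 7 + 3 * θ ^ 3)) = 1 := by linear_combination -hθ
    have hsq : (2 * θ ^ 4 + 3) ^ 2 = 5 := by linear_combination 4 * hθ
    calc (8 * θ ^ 7 + 12 * θ ^ 3) * (-(θ ^ 7 + 3 * θ ^ 3) ^ 3 * (2 * θ ^ 4 + 3))
        = 4 * (θ * (-(θ ^ 7 + 3 * θ ^ 3))) ^ 3 * (2 * θ ^ 4 + 3) ^ 2 := by ring
      _ = 2 * 2 * 5 := by rw [hinv, hsq]; norm_num
  refine le_antisymm hA fun z hz ↦ ?_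
  exact hcancel z hz (aeval_derivative_mul_mem_adjoin hint htop hz)

/-- A group of order 8 in which some `r` with `r ^ 4 = 1`, `r ^ 2 ≠ 1` is inverted by an involution
`s` is dihedral. -/
lemma nonempty_mulEquiv_dihedralGroup_four {G : Type*} [Group G] (hcard : Nat.card G = 8) {r s : G}
    (hr : r ^ 4 = 1) (hr2 : r ^ 2 ≠ 1) (hs : s * s = 1) (hsr : s * r = r⁻¹ * s) :
    Nonempty (G ≃* DihedralGroup 4) := by
  have hr0 : (zmultiplesHom (Additive G) (Additive.ofMul r)) (4 : ℕ) = 0 := by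
    have h4 : (4 : ℤ) • Additive.ofMul r = 0 :=
      congrArg Additive.ofMul (by simpa using hr : r ^ (4 : ℤ) = 1)
    simpa using h4
  let f : ZMod 4 →+ Additive G := ZMod.lift 4 ⟨zmultiplesHom (Additive G) (Additive.ofMul r), hr0⟩
  let g : ZMod 4 → G := fun k ↦ (f k).toMul
  have hgadd : ∀ k l, g (k + l) = g k * g l := fun k l ↦ by simp [g]
  have hgz : ∀ n : ℤ, g n = r ^ n := fun n ↦ by simp [g, f]
  have hgs : ∀ k, g k * s = s * g (-k) := by
    intro k
    obtain ⟨n, rfl⟩ := ZMod.intCast_surjective k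
    have hconj : s * r * s⁻¹ = r⁻¹ := by rw [hsr]; group
    have hconj' : s * r ^ (-n) * s⁻¹ = r ^ n := by
      rw [← conj_zpow, hconj, inv_zpow, zpow_neg, inv_inv]
    rw [← Int.cast_neg, hgz, hgz, ← hconj']
    group
  let F : DihedralGroup 4 →* G := MonoidHom.mk' (fun x ↦ match x with
      | .r k => g k
      | .sr k => s * g k) (by
    rintro (k | k) (l | l)
    · exact hgadd k l
    · simp only [DihedralGroup.r_mul_sr]
      rw [← mul_assoc, hgs, mul_assoc, ← hgadd, neg_add_eq_sub]
    · simp only [DihedralGroup.sr_mul_r]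
      rw [hgadd, mul_assoc]
    · simp only [DihedralGroup.sr_mul_sr]
      rw [mul_assoc, ← mul_assoc (g k), hgs, ← mul_assoc, ← mul_assoc, hs, one_mul, ← hgadd,
        neg_add_eq_sub])
  have hg1 : g 1 = r := by simpa using hgz 1
  have hg2 : g 2 = r ^ 2 := by
    rw [show (2 : ZMod 4) = 1 + 1 from rfl, hgadd, hg1, pow_two]
  have hinj : Function.Injective F := by
    rw [injective_iff_map_eq_one]
    rintro (k | k) hk
    · change g k = 1 at hk
      have h2k : g (k + k) = 1 := by rw [hgadd, hk, one_mul]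
      have : ∀ k : ZMod 4, k = 0 ∨ k = 2 ∨ k + k = 2 := by decide
      rcases this k with rfl | rfl | h
      · rfl
      · exact absurd (hg2 ▸ hk) hr2
      · exact absurd (hg2 ▸ h ▸ h2k) hr2
    · change s * g k = 1 at hk
      have hsk : s = g (-k) := by
        rw [eq_inv_of_mul_eq_one_left hk, inv_eq_iff_mul_eq_one, ← hgadd, add_neg_cancel]
        simp [g]
      have hcomm : s * r = r * s := by
        rw [hsk, ← hg1, ← hgadd, ← hgadd, add_comm]
      rw [hsr, mul_left_inj] at hcomm
      refine absurd ?_ hr2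
      rw [pow_two]
      nth_rewrite 1 [← hcomm]
      exact inv_mul_cancel r
  have hbij : Function.Bijective F := by
    have : Finite G := Nat.finite_of_card_ne_zero (by rw [hcard]; norm_num)
    exact hinj.bijective_of_nat_card_le (by rw [hcard, DihedralGroup.nat_card])
  exact ⟨(MulEquiv.ofBijective F hbij).symm⟩

/-- All roots of `x⁸ + 3x⁴ + 1` lie in the field generated by one of them. -/
lemma mem_adjoin_of_root {K : Type*} [Field K] [Algebra ℚ K] {θ x : K}
    (hθ : θ ^ 8 + 3 * θ ^ 4 + 1 = 0) (hx : x ^ 8 + 3 * x ^ 4 + 1 = 0) :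
    x ∈ Algebra.adjoin ℚ {θ} := by
  have hi := sq_eq_neg_one_of_root hθ
  have haeval : ∀ p : ℚ[X], aeval θ p ∈ Algebra.adjoin ℚ {θ} :=
    fun p ↦ aeval_mem_adjoin_singleton ℚ θ
  have himem := haeval (-(X ^ 6 + 2 * X ^ 2))
  have hmem := haeval X
  have hinvmem := haeval (-(X ^ 7 + 3 * X ^ 3))
  simp only [map_neg, map_add, map_mul, map_pow, aeval_X, map_ofNat] at himem hmem hinvmem
  have key : ∀ y ∈ Algebra.adjoin ℚ {θ}, x ^ 4 = y ^ 4 → x ∈ Algebra.adjoin ℚ {θ} := by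
    intro y hy h
    rcases eq_of_pow_four_eq hi h with h | h | h | h <;> rw [h]
    · exact hy
    · exact neg_mem hy
    · exact mul_mem himem hy
    · exact neg_mem (mul_mem himem hy)
  have hfac : (x ^ 4 - θ ^ 4) * (x ^ 4 + 3 + θ ^ 4) = 0 := by linear_combination hx - hθ
  rcases mul_eq_zero.1 hfac with h | h
  · exact key θ hmem (sub_eq_zero.1 h)
  · refine key _ hinvmem ?_
    have hinv : θ * (-(θ ^ 7 + 3 * θ ^ 3)) = 1 := by linear_combination -hθ
    have hinv4 : θ ^ 4 * (-(θ ^ 7 + 3 * θ ^ 3)) ^ 4 = 1 := by rw [← mul_pow, hinv, one_pow]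
    linear_combination h + (θ ^ 4 + 3) * hinv4 - (-(θ ^ 7 + 3 * θ ^ 3)) ^ 4 * hθ

lemma nonempty_gal_mulEquiv_of_root {K : Type*} [Field K] [NumberField K] [IsGalois ℚ K] {θ : K}
    (h : θ ^ 8 + (3 : ℤ) * θ ^ 4 + (1 : ℤ) = 0) (htop : Algebra.adjoin ℚ {θ} = ⊤) :
    Nonempty ((K ≃ₐ[ℚ] K) ≃* DihedralGroup 4) := by
  have hirr := octicRat_three_one_irreducible
  have hθ : θ ^ 8 + 3 * θ ^ 4 + 1 = 0 := by simpa using h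
  have hθ0 := ne_zero_of_irreducible hirr h
  have hcard : Nat.card (K ≃ₐ[ℚ] K) = 8 := by
    have hprim : IntermediateField.adjoin ℚ {θ} = ⊤ := by
      apply IntermediateField.toSubalgebra_injective
      rw [IntermediateField.adjoin_simple_toSubalgebra_of_isAlgebraic
        (Algebra.IsAlgebraic.isAlgebraic θ), htop, IntermediateField.top_toSubalgebra]
    rw [IsGalois.card_aut_eq_finrank,
      ← (Field.primitive_element_iff_minpoly_natDegree_eq ℚ θ).1 hprim,
      minpoly_eq_octicRat hirr h, natDegree_map_eq_of_injective Int.cast_injective,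
      octic_natDegree]
  obtain ⟨i, hidef⟩ : ∃ i : K, i = -(θ ^ 6 + 2 * θ ^ 2) := ⟨_, rfl⟩
  have hi : i ^ 2 = -1 := hidef ▸ sq_eq_neg_one_of_root hθ
  have hiθ : i * θ ^ 2 = θ ^ 4 + 1 := by rw [hidef]; linear_combination -hθ
  have hi0 : i ≠ 0 := by rintro rfl; norm_num at hi
  obtain ⟨σ, hσ⟩ := exists_algEquiv_apply_eq hirr h (x := i * θ) (by
    push_cast
    linear_combination hθ + (i ^ 2 - 1) * (θ ^ 8 * (i ^ 4 + 1) + 3 * θ ^ 4) * hi)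
  obtain ⟨τ, hτ⟩ := exists_algEquiv_apply_eq hirr h (x := θ⁻¹) (by
    push_cast
    field_simp
    linear_combination hθ)
  have hσi : σ i = -i := by
    rw [hidef, map_neg, map_add, map_mul, map_pow, map_pow, hσ, map_ofNat]
    linear_combination -(θ ^ 6 * (i ^ 4 - i ^ 2 + 1) + 2 * θ ^ 2) * hi
  have hτi : τ i = i := by
    have h1 := congrArg τ hiθ
    simp only [map_mul, map_add, map_pow, hτ, map_one] at h1
    field_simp at h1
    apply mul_right_cancel₀ (pow_ne_zero 2 hθ0)
    linear_combination h1 - hiθ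
  have hσσ : σ * σ = 1 := algEquiv_ext_of_adjoin_eq_top htop (by
    rw [AlgEquiv.mul_apply, hσ, map_mul, hσ, hσi, AlgEquiv.one_apply]
    linear_combination -θ * hi)
  have hττ : τ * τ = 1 := algEquiv_ext_of_adjoin_eq_top htop (by
    rw [AlgEquiv.mul_apply, hτ, map_inv₀, hτ, inv_inv, AlgEquiv.one_apply])
  have hσinv : σ⁻¹ = σ := inv_eq_of_mul_eq_one_left hσσ
  have hτinv : τ⁻¹ = τ := inv_eq_of_mul_eq_one_left hττ
  have hr : (σ * τ) θ = (i * θ)⁻¹ := by rw [AlgEquiv.mul_apply, hτ, map_inv₀, hσ]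
  have hri : (σ * τ) i = -i := by rw [AlgEquiv.mul_apply, hτi, hσi]
  have hr2 : ((σ * τ) ^ 2) θ = -θ := by
    rw [pow_two, AlgEquiv.mul_apply, hr, map_inv₀, map_mul, hr, hri]
    field_simp
  refine nonempty_mulEquiv_dihedralGroup_four hcard (r := σ * τ) (s := σ) ?_ ?_ hσσ ?_
  · refine algEquiv_ext_of_adjoin_eq_top htop ?_
    rw [show 4 = 2 + 2 from rfl, pow_add, AlgEquiv.mul_apply, hr2, map_neg, hr2, neg_neg,
      AlgEquiv.one_apply]
  · intro h1
    rw [h1, AlgEquiv.one_apply] at hr2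
    exact hθ0 (self_eq_neg.1 hr2)
  · rw [mul_inv_rev, hσinv, hτinv, ← mul_assoc, hσσ, one_mul, mul_assoc, hσσ, mul_one]

lemma nonempty_gal_octicRat_three_one_mulEquiv :
    Nonempty ((octicRat 3 1).Gal ≃* DihedralGroup 4) := by
  have hsplitting : IsSplittingField ℚ (octicRat 3 1).SplittingField (octicRat 3 1) :=
    IsSplittingField.splittingField _
  have : IsGalois ℚ (octicRat 3 1).SplittingField :=
    IsGalois.of_separable_splitting_field octicRat_three_one_irreducible.separable
  have : NumberField (octicRat 3 1).SplittingField := { }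
  obtain ⟨θ, hθ⟩ := hsplitting.splits.exists_eval_eq_zero (by
    rw [degree_map]; exact (degree_pos_of_irreducible octicRat_three_one_irreducible).ne')
  rw [eval_map_algebraMap, aeval_octicRat] at hθ
  refine nonempty_gal_mulEquiv_of_root hθ (top_le_iff.1 ?_)
  rw [← hsplitting.adjoin_rootSet]
  refine Algebra.adjoin_le fun x hx ↦ ?_
  have hx := (mem_rootSet.1 hx).2
  rw [aeval_octicRat] at hx
  exact mem_adjoin_of_root (by simpa using hθ) (by simpa using hx)

theorem stmt_8 (a b : ℤ) :
    (IsMonogenic (X ^ 8 + C a * X ^ 4 + C b) ∧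
      Nonempty ((((X ^ 8 + C a * X ^ 4 + C b : Polynomial ℤ).map (Int.castRingHom ℚ)).Gal ≃*
        DihedralGroup 4))) ↔
    (a = 3 ∧ b = 1) := by
  constructor
  · rintro ⟨hmono, ⟨e⟩⟩
    exact coeffs_of_isMonogenic_of_gal hmono e
  · rintro ⟨rfl, rfl⟩
    exact ⟨isMonogenic_octic_three_one, nonempty_gal_octicRat_three_one_mulEquiv⟩
end
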